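/- Corollary 1: the optimal rate region achievable by the Han--Kobayashi random code ensemble equals the Han--Kobayashi inner bound, R_opt = R_HK. Consequently, the Han--Kobayashi inner bound cannot be enlarged by replacing the decoders of the Han--Kobayashi scheme with optimal maximum likelihood decoders. -/

import Mathlib

open scoped BigOperators
open Filter

set_option synthInstance.maxSize 4000
set_option synthInstance.maxHeartbeats 1000000
set_option maxHeartbeats 1000000

noncomputable section

/-- Shannon entropy (base 2) of a finitely supported distribution `p`. -/
def ent {α : Type*} [Fintype α] (p : α → ℝ) : ℝ := -∑ a, p a * Real.logb 2 (p a)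

/-- The distribution (pushforward) of a random variable `f` on the finite
probability space `(Ω, p)`. -/
def distOf {Ω β : Type*} [Fintype Ω] [DecidableEq β] (p : Ω → ℝ) (f : Ω → β) : β → ℝ :=
  fun b => ∑ ω, if f ω = b then p ω else 0

/-- The entropy `H(f)` of a random variable `f` on the finite probability space `(Ω, p)`. -/
def entOf {Ω β : Type*} [Fintype Ω] [Fintype β] [DecidableEq β] (p : Ω → ℝ) (f : Ω → β) : ℝ :=
  ent (distOf p f)

/-- The conditional entropy `H(f | g)`. -/
def condEnt {Ω β γ : Type*} [Fintype Ω] [Fintype β] [Fintype γ] [DecidableEq β] [DecidableEq γ]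
    (p : Ω → ℝ) (f : Ω → β) (g : Ω → γ) : ℝ :=
  entOf p (fun ω => (f ω, g ω)) - entOf p g

/-- The mutual information `I(f; g)`. -/
def mutInfo {Ω β γ : Type*} [Fintype Ω] [Fintype β] [Fintype γ] [DecidableEq β] [DecidableEq γ]
    (p : Ω → ℝ) (f : Ω → β) (g : Ω → γ) : ℝ :=
  entOf p f + entOf p g - entOf p (fun ω => (f ω, g ω))

/-- The conditional mutual information `I(f; g | h)`. -/
def condMutInfo {Ω β γ δ : Type*} [Fintype Ω] [Fintype β] [Fintype γ] [Fintype δ]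
    [DecidableEq β] [DecidableEq γ] [DecidableEq δ]
    (p : Ω → ℝ) (f : Ω → β) (g : Ω → γ) (h : Ω → δ) : ℝ :=
  entOf p (fun ω => (f ω, h ω)) + entOf p (fun ω => (g ω, h ω)) -
    entOf p (fun ω => (f ω, g ω, h ω)) - entOf p h

/-- `p` is a probability mass function on the finite alphabet `α`. -/
def IsPMF {α : Type*} [Fintype α] (p : α → ℝ) : Prop := (∀ a, 0 ≤ p a) ∧ ∑ a, p a = 1

/-- The number `2^{nR}` of messages at blocklength `n` and rate `R` (in bits). -/
def msgSize (n : ℕ) (R : ℝ) : ℕ := max 1 ⌊(2 : ℝ) ^ ((n : ℝ) * R)⌋₊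

instance (n : ℕ) (R : ℝ) : NeZero (msgSize n R) :=
  ⟨by have h : 1 ≤ msgSize n R := le_max_left _ _; omega⟩

/-- The `ε`-typical set: `xs` is `ε`-typical for the pmf `p` if the empirical frequency of
every symbol `a` is within `ε · p a` of `p a`. -/
def Typical {α : Type*} [Fintype α] [DecidableEq α] (p : α → ℝ) (ε : ℝ) {n : ℕ}
    (xs : Fin n → α) : Prop :=
  ∀ a, |((Finset.univ.filter fun i => xs i = a).card : ℝ) / (n : ℝ) - p a| ≤ ε * p a

section HanKobayashi

variable {Qt U11 U12 U21 U22 X1 X2 Y1 Y2 : Type*}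
  [Fintype Qt] [DecidableEq Qt] [Fintype U11] [DecidableEq U11] [Fintype U12] [DecidableEq U12]
  [Fintype U21] [DecidableEq U21] [Fintype U22] [DecidableEq U22]
  [Fintype X1] [DecidableEq X1] [Fintype X2] [DecidableEq X2]
  [Fintype Y1] [DecidableEq Y1] [Fintype Y2] [DecidableEq Y2]

variable (W : X1 → X2 → Y1 × Y2 → ℝ)
variable (pq : Qt → ℝ) (p11 : Qt → U11 → ℝ) (p12 : Qt → U12 → ℝ)
  (p21 : Qt → U21 → ℝ) (p22 : Qt → U22 → ℝ)
  (g1 : U11 → U12 → X1) (g2 : U21 → U22 → X2)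

/-- The single-letter joint distribution of `(Q, U11, U12, U21, U22, Y1, Y2)` for
Han–Kobayashi coding: the auxiliaries are conditionally independent given `Q`, the inputs
are `X1 = x1(U11, U12)` and `X2 = x2(U21, U22)`, and the outputs come from the channel. -/
def hkJointP : Qt × U11 × U12 × U21 × U22 × Y1 × Y2 → ℝ := fun z =>
  pq z.1 * p11 z.1 z.2.1 * p12 z.1 z.2.2.1 * p21 z.1 z.2.2.2.1 * p22 z.1 z.2.2.2.2.1 *
    W (g1 z.2.1 z.2.2.1) (g2 z.2.2.2.1 z.2.2.2.2.1) (z.2.2.2.2.2.1, z.2.2.2.2.2.2)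

def hQ : Qt × U11 × U12 × U21 × U22 × Y1 × Y2 → Qt := fun z => z.1
def hU11 : Qt × U11 × U12 × U21 × U22 × Y1 × Y2 → U11 := fun z => z.2.1
def hU12 : Qt × U11 × U12 × U21 × U22 × Y1 × Y2 → U12 := fun z => z.2.2.1
def hU21 : Qt × U11 × U12 × U21 × U22 × Y1 × Y2 → U21 := fun z => z.2.2.2.1
def hU22 : Qt × U11 × U12 × U21 × U22 × Y1 × Y2 → U22 := fun z => z.2.2.2.2.1
def hY1 : Qt × U11 × U12 × U21 × U22 × Y1 × Y2 → Y1 := fun z => z.2.2.2.2.2.1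
def hY2 : Qt × U11 × U12 × U21 × U22 × Y1 × Y2 → Y2 := fun z => z.2.2.2.2.2.2

/-- The constraints of `𝓡_{HK,1}(p)` (receiver 1 recovers `M11, M12, M21`). -/
def HK1holds (a b c d : ℝ) : Prop :=
  a ≤ condMutInfo (hkJointP W pq p11 p12 p21 p22 g1 g2) hU11 hY1
      (fun z => (hU12 z, hU21 z, hQ z)) ∧
  b ≤ condMutInfo (hkJointP W pq p11 p12 p21 p22 g1 g2) hU12 hY1
      (fun z => (hU11 z, hU21 z, hQ z)) ∧
  c ≤ condMutInfo (hkJointP W pq p11 p12 p21 p22 g1 g2) hU21 hY1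
      (fun z => (hU11 z, hU12 z, hQ z)) ∧
  a + b ≤ condMutInfo (hkJointP W pq p11 p12 p21 p22 g1 g2)
      (fun z => (hU11 z, hU12 z)) hY1 (fun z => (hU21 z, hQ z)) ∧
  a + c ≤ condMutInfo (hkJointP W pq p11 p12 p21 p22 g1 g2)
      (fun z => (hU11 z, hU21 z)) hY1 (fun z => (hU12 z, hQ z)) ∧
  b + c ≤ condMutInfo (hkJointP W pq p11 p12 p21 p22 g1 g2)
      (fun z => (hU12 z, hU21 z)) hY1 (fun z => (hU11 z, hQ z)) ∧
  a + b + c ≤ condMutInfo (hkJointP W pq p11 p12 p21 p22 g1 g2)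
      (fun z => (hU11 z, hU12 z, hU21 z)) hY1 hQ

/-- The constraints of `𝓡_{HK,2}(p)` (receiver 2 recovers `M21, M22, M12`); obtained from
`𝓡_{HK,1}(p)` by exchanging the sender/receiver indices `1 ↔ 2`. -/
def HK2holds (a b c d : ℝ) : Prop :=
  d ≤ condMutInfo (hkJointP W pq p11 p12 p21 p22 g1 g2) hU22 hY2
      (fun z => (hU21 z, hU12 z, hQ z)) ∧
  c ≤ condMutInfo (hkJointP W pq p11 p12 p21 p22 g1 g2) hU21 hY2
      (fun z => (hU22 z, hU12 z, hQ z)) ∧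
  b ≤ condMutInfo (hkJointP W pq p11 p12 p21 p22 g1 g2) hU12 hY2
      (fun z => (hU21 z, hU22 z, hQ z)) ∧
  c + d ≤ condMutInfo (hkJointP W pq p11 p12 p21 p22 g1 g2)
      (fun z => (hU21 z, hU22 z)) hY2 (fun z => (hU12 z, hQ z)) ∧
  d + b ≤ condMutInfo (hkJointP W pq p11 p12 p21 p22 g1 g2)
      (fun z => (hU22 z, hU12 z)) hY2 (fun z => (hU21 z, hQ z)) ∧
  c + b ≤ condMutInfo (hkJointP W pq p11 p12 p21 p22 g1 g2)
      (fun z => (hU21 z, hU12 z)) hY2 (fun z => (hU22 z, hQ z)) ∧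
  c + d + b ≤ condMutInfo (hkJointP W pq p11 p12 p21 p22 g1 g2)
      (fun z => (hU21 z, hU22 z, hU12 z)) hY2 hQ

/-- A codebook for the Han–Kobayashi random code ensemble: a time-sharing sequence and one
codeword per message for each of the four message parts. -/
abbrev HKCodebook (Qt U11 U12 U21 U22 : Type*) (n M11 M12 M21 M22 : ℕ) : Type _ :=
  (Fin n → Qt) × (Fin M11 → Fin n → U11) × (Fin M12 → Fin n → U12) ×
    (Fin M21 → Fin n → U21) × (Fin M22 → Fin n → U22)

/-- The probability of a codebook under the Han–Kobayashi random code ensemble. -/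
def hkEnsembleP {n M11 M12 M21 M22 : ℕ}
    (c : HKCodebook Qt U11 U12 U21 U22 n M11 M12 M21 M22) : ℝ :=
  (∏ i, pq (c.1 i)) * (∏ m, ∏ i, p11 (c.1 i) (c.2.1 m i)) *
    (∏ m, ∏ i, p12 (c.1 i) (c.2.2.1 m i)) * (∏ m, ∏ i, p21 (c.1 i) (c.2.2.2.1 m i)) *
    (∏ m, ∏ i, p22 (c.1 i) (c.2.2.2.2 m i))

/-- The average probability of error (over uniform messages) of the Han–Kobayashi code
with codebook `c` and decoders `d1`, `d2`; each receiver must recover both of its own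
message parts. -/
def hkPeCode {n M11 M12 M21 M22 : ℕ}
    (c : HKCodebook Qt U11 U12 U21 U22 n M11 M12 M21 M22)
    (d1 : (Fin n → Y1) → Fin M11 × Fin M12) (d2 : (Fin n → Y2) → Fin M21 × Fin M22) : ℝ :=
  ((M11 : ℝ) * (M12 : ℝ) * (M21 : ℝ) * (M22 : ℝ))⁻¹ *
    ∑ m11, ∑ m12, ∑ m21, ∑ m22, ∑ y1 : Fin n → Y1, ∑ y2 : Fin n → Y2,
      (∏ i, W (g1 (c.2.1 m11 i) (c.2.2.1 m12 i)) (g2 (c.2.2.2.1 m21 i) (c.2.2.2.2 m22 i))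
        (y1 i, y2 i)) *
        (if d1 y1 = (m11, m12) ∧ d2 y2 = (m21, m22) then 0 else 1)

/-- The probability of error of the codebook `c` under optimal (maximum likelihood)
decoding of the demanded messages. -/
def hkPeOpt {n M11 M12 M21 M22 : ℕ}
    (c : HKCodebook Qt U11 U12 U21 U22 n M11 M12 M21 M22) : ℝ :=
  ⨅ d : ((Fin n → Y1) → Fin M11 × Fin M12) × ((Fin n → Y2) → Fin M21 × Fin M22),
    hkPeCode W g1 g2 c d.1 d.2

/-- The probability of error under optimal decoding at blocklength `n` and rate tuple
`(R11, R12, R21, R22)`, averaged over the Han–Kobayashi random code ensemble. -/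
def hkAvgPe (R11 R12 R21 R22 : ℝ) (n : ℕ) : ℝ :=
  ∑ c : HKCodebook Qt U11 U12 U21 U22 n (msgSize n R11) (msgSize n R12)
      (msgSize n R21) (msgSize n R22),
    hkEnsembleP pq p11 p12 p21 p22 c * hkPeOpt W g1 g2 c

end HanKobayashi

section Corollary1

variable {X1 X2 Y1 Y2 : Type*} [Fintype X1] [DecidableEq X1] [Fintype X2] [DecidableEq X2]
  [Fintype Y1] [DecidableEq Y1] [Fintype Y2] [DecidableEq Y2]
variable (W : X1 → X2 → Y1 × Y2 → ℝ)

/-- The Han–Kobayashi inner bound `𝓡_HK`: the union over all pmfs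
`p = p(q) p(u11|q) p(u12|q) p(u21|q) p(u22|q)` (on finite auxiliary alphabets) and
deterministic maps `x1(u11, u12)`, `x2(u21, u22)` of the projection
`(R11, R12, R21, R22) ↦ (R11 + R12, R21 + R22)` of `𝓡_{HK,1}(p) ∩ 𝓡_{HK,2}(p)`. -/
def RHK : Set (ℝ × ℝ) :=
  {r | ∃ (nq n11 n12 n21 n22 : ℕ) (pq : Fin nq → ℝ) (p11 : Fin nq → Fin n11 → ℝ)
      (p12 : Fin nq → Fin n12 → ℝ) (p21 : Fin nq → Fin n21 → ℝ) (p22 : Fin nq → Fin n22 → ℝ)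
      (g1 : Fin n11 → Fin n12 → X1) (g2 : Fin n21 → Fin n22 → X2),
    IsPMF pq ∧ (∀ q, IsPMF (p11 q)) ∧ (∀ q, IsPMF (p12 q)) ∧ (∀ q, IsPMF (p21 q)) ∧
      (∀ q, IsPMF (p22 q)) ∧
    ∃ R11 R12 R21 R22 : ℝ, 0 ≤ R11 ∧ 0 ≤ R12 ∧ 0 ≤ R21 ∧ 0 ≤ R22 ∧
      r = (R11 + R12, R21 + R22) ∧
      HK1holds W pq p11 p12 p21 p22 g1 g2 R11 R12 R21 R22 ∧
      HK2holds W pq p11 p12 p21 p22 g1 g2 R11 R12 R21 R22}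

/-- The optimal rate region `𝓡_opt` achievable by the Han–Kobayashi random code ensemble:
the union over all pmfs `p` and deterministic maps of the projection
`(R11, R12, R21, R22) ↦ (R11 + R12, R21 + R22)` of the optimal rate region `𝓡*(p)`, i.e.
of the closure of the set of rate tuples whose ensemble-average error probability under
optimal decoding vanishes. -/
def Ropt : Set (ℝ × ℝ) :=
  {r | ∃ (nq n11 n12 n21 n22 : ℕ) (pq : Fin nq → ℝ) (p11 : Fin nq → Fin n11 → ℝ)
      (p12 : Fin nq → Fin n12 → ℝ) (p21 : Fin nq → Fin n21 → ℝ) (p22 : Fin nq → Fin n22 → ℝ)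
      (g1 : Fin n11 → Fin n12 → X1) (g2 : Fin n21 → Fin n22 → X2),
    IsPMF pq ∧ (∀ q, IsPMF (p11 q)) ∧ (∀ q, IsPMF (p12 q)) ∧ (∀ q, IsPMF (p21 q)) ∧
      (∀ q, IsPMF (p22 q)) ∧
    ∃ v : ℝ × ℝ × ℝ × ℝ,
      v ∈ closure {u : ℝ × ℝ × ℝ × ℝ | 0 ≤ u.1 ∧ 0 ≤ u.2.1 ∧ 0 ≤ u.2.2.1 ∧ 0 ≤ u.2.2.2 ∧
        Tendsto (fun n => hkAvgPe W pq p11 p12 p21 p22 g1 g2 u.1 u.2.1 u.2.2.1 u.2.2.2 n)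
          atTop (nhds 0)} ∧
      r = (v.1 + v.2.1, v.2.2.1 + v.2.2.2)}

set_option linter.unusedSectionVars false

/-! ### Product weights on finite product spaces -/

section ProductWeights

variable {ι : Type*} [Fintype ι] [DecidableEq ι] {A : ι → Type*} [∀ j, Fintype (A j)]

/-- The product weight `∏ j, P j (x j)` on a finite product space. -/
def prodW (P : ∀ j, A j → ℝ) (x : ∀ j, A j) : ℝ := ∏ j, P j (x j)

lemma prodW_nonneg {P : ∀ j, A j → ℝ} (hP : ∀ j a, 0 ≤ P j a) (x : ∀ j, A j) :
    0 ≤ prodW P x := Finset.prod_nonneg fun j _ => hP j _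

lemma isPMF_prodW {P : ∀ j, A j → ℝ} (hP : ∀ j, IsPMF (P j)) : IsPMF (prodW P) := by
  refine ⟨prodW_nonneg fun j a => (hP j).1 a, ?_⟩
  simp only [prodW]
  rw [← Fintype.prod_sum]
  exact Finset.prod_eq_one fun j _ => (hP j).2

lemma sum_prodW_mul_prod (P f : ∀ j, A j → ℝ) :
    ∑ x, prodW P x * ∏ j, f j (x j) = ∏ j, ∑ a, P j a * f j a := by
  rw [Fintype.prod_sum]
  simp only [prodW, Finset.prod_mul_distrib]

/-- Exchanging the coordinates outside `S` between two points is a bijection of pairs. -/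
lemma sum_sum_piecewise_swap (S : Finset ι) (F : (∀ j, A j) → (∀ j, A j) → ℝ) :
    ∑ x, ∑ x', F (S.piecewise x x') (S.piecewise x' x) = ∑ x, ∑ x', F x x' := by
  rw [← Fintype.sum_prod_type', ← Fintype.sum_prod_type']
  have hinv : Function.Involutive (fun z : (∀ j, A j) × (∀ j, A j) =>
      ((S.piecewise z.1 z.2, S.piecewise z.2 z.1) : (∀ j, A j) × (∀ j, A j))) := by
    rintro ⟨x, x'⟩
    ext j <;> by_cases hj : j ∈ S <;> simp [hj]
  exact Fintype.sum_equiv hinv.toPerm _ _ fun z => rfl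

lemma prodW_piecewise_mul (P : ∀ j, A j → ℝ) (S : Finset ι) (x x' : ∀ j, A j) :
    prodW P (S.piecewise x x') * prodW P (S.piecewise x' x) = prodW P x * prodW P x' := by
  simp only [prodW, ← Finset.prod_mul_distrib]
  refine Finset.prod_congr rfl fun j _ => ?_
  by_cases hj : j ∈ S <;> simp [hj, mul_comm]

lemma sum_sum_prodW_piecewise (P : ∀ j, A j → ℝ) (S : Finset ι)
    (F : (∀ j, A j) → (∀ j, A j) → ℝ) :
    ∑ x, ∑ x', prodW P x * prodW P x' * F (S.piecewise x x') (S.piecewise x' x) =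
      ∑ x, ∑ x', prodW P x * prodW P x' * F x x' := by
  rw [← sum_sum_piecewise_swap S (fun x x' => prodW P x * prodW P x' * F x x')]
  simp only [prodW_piecewise_mul]

lemma sum_sum_prodW_piecewise_left {P : ∀ j, A j → ℝ} (hP : ∀ j, IsPMF (P j)) (S : Finset ι)
    (G : (∀ j, A j) → ℝ) :
    ∑ x, ∑ x', prodW P x * prodW P x' * G (S.piecewise x x') = ∑ x, prodW P x * G x := by
  rw [sum_sum_prodW_piecewise P S (fun x _ => G x)]
  refine Finset.sum_congr rfl fun x _ => ?_
  rw [← Finset.sum_mul, ← Finset.mul_sum, (isPMF_prodW hP).2, mul_one]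

lemma sum_mul_eq_sum_indicator {X : Type*} [Fintype X] {Z : Type*} [Fintype Z] [DecidableEq Z]
    (w : X → ℝ) (φ : X → Z) (f : Z → ℝ) :
    ∑ x, w x * f (φ x) = ∑ z, f z * ∑ x, w x * (if φ x = z then 1 else 0) := by
  simp only [Finset.mul_sum]
  rw [Finset.sum_comm]
  refine Finset.sum_congr rfl fun x _ => ?_
  simp [mul_comm]

/-- Two product weights whose coordinates have the same pushforwards have the same
pushforward. -/
lemma sum_prodW_pushforward {B Z : ι → Type*} [∀ j, Fintype (B j)] [∀ j, Fintype (Z j)]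
    [∀ j, DecidableEq (Z j)] (P : ∀ j, A j → ℝ) (P' : ∀ j, B j → ℝ)
    (φ : ∀ j, A j → Z j) (ψ : ∀ j, B j → Z j)
    (h : ∀ j (f : Z j → ℝ), ∑ a, P j a * f (φ j a) = ∑ b, P' j b * f (ψ j b))
    (F : (∀ j, Z j) → ℝ) :
    ∑ x, prodW P x * F (fun j => φ j (x j)) = ∑ x, prodW P' x * F (fun j => ψ j (x j)) := by
  rw [sum_mul_eq_sum_indicator (prodW P) (fun x j => φ j (x j)) F,
    sum_mul_eq_sum_indicator (prodW P') (fun x j => ψ j (x j)) F]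
  refine Finset.sum_congr rfl fun z _ => ?_
  congr 1
  have hA : ∀ x : ∀ j, A j, (if (fun j => φ j (x j)) = z then (1 : ℝ) else 0) =
        ∏ j, if φ j (x j) = z j then 1 else 0 := fun x => by
    rw [Fintype.prod_ite_zero]; simp [funext_iff]
  have hB : ∀ x : ∀ j, B j, (if (fun j => ψ j (x j)) = z then (1 : ℝ) else 0) =
        ∏ j, if ψ j (x j) = z j then 1 else 0 := fun x => by
    rw [Fintype.prod_ite_zero]; simp [funext_iff]
  simp only [hA, hB]
  rw [sum_prodW_mul_prod P (fun j a => if φ j a = z j then 1 else 0),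
    sum_prodW_mul_prod P' (fun j a => if ψ j a = z j then 1 else 0)]
  exact Finset.prod_congr rfl fun j _ => h j (fun w => if w = z j then 1 else 0)

end ProductWeights

section Codewords

variable {K X : Type*} [Fintype K] [DecidableEq K] [Fintype X]

lemma sum_prod_mul_coord {P : X → ℝ} (hP : IsPMF P) (s : K) (f : X → ℝ) :
    ∑ x : K → X, (∏ k, P (x k)) * f (x s) = ∑ a, P a * f a := by
  have h := sum_prodW_mul_prod (fun _ : K => P) (fun k a => if k = s then f a else 1)
  simp only [prodW] at h
  have h1 : ∀ x : K → X, (∏ k, if k = s then f (x k) else 1) = f (x s) := fun x => by simp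
  simp only [h1] at h
  rw [h, Finset.prod_eq_single s]
  · simp
  · intro k _ hk
    simp [hk, hP.2]
  · simp

lemma sum_prod_mul_coord_coord {P : X → ℝ} (hP : IsPMF P) {s t : K} (hst : s ≠ t)
    (f g : X → ℝ) :
    ∑ x : K → X, (∏ k, P (x k)) * (f (x s) * g (x t)) =
      (∑ a, P a * f a) * ∑ a, P a * g a := by
  have h := sum_prodW_mul_prod (fun _ : K => P)
    (fun k a => (if k = s then f a else 1) * if k = t then g a else 1)
  simp only [prodW] at h
  have h1 : ∀ x : K → X, (∏ k, (if k = s then f (x k) else 1) * if k = t then g (x k) else 1) =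
      f (x s) * g (x t) := fun x => by
    rw [Finset.prod_mul_distrib]; simp
  simp only [h1] at h
  rw [h, ← Finset.mul_prod_erase _ _ (Finset.mem_univ s),
    ← Finset.mul_prod_erase _ _ (Finset.mem_erase.2 ⟨hst.symm, Finset.mem_univ t⟩),
    Finset.prod_eq_one]
  · simp [hst, hst.symm]
  · intro k hk
    simp only [Finset.mem_erase, Finset.mem_univ, and_true] at hk
    simp [hk.1, hk.2, hP.2]

/-- The joint law of two codewords of an i.i.d. codebook. -/
lemma sum_prod_mul_pair [DecidableEq X] {P : X → ℝ} (hP : IsPMF P) (s t : K)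
    (f : X × X → ℝ) :
    ∑ x : K → X, (∏ k, P (x k)) * f (x s, x t) =
      ∑ z : X × X, P z.1 * P z.2 * f (z.1, if s = t then z.1 else z.2) := by
  by_cases hst : s = t
  · subst hst
    simp only [if_true]
    rw [sum_prod_mul_coord hP s (fun a => f (a, a)), Fintype.sum_prod_type]
    refine Finset.sum_congr rfl fun a _ => ?_
    simp only
    rw [← Finset.sum_mul, ← Finset.mul_sum, hP.2, mul_one]
  · simp only [hst, if_false]
    rw [sum_mul_eq_sum_indicator (fun x : K → X => ∏ k, P (x k)) (fun x => (x s, x t)) f]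
    refine Finset.sum_congr rfl fun z _ => ?_
    have h := sum_prod_mul_coord_coord hP hst (fun a => if a = z.1 then 1 else 0)
      (fun a => if a = z.2 then 1 else 0)
    have h2 : ∀ x : K → X, (if (x s, x t) = z then (1 : ℝ) else 0) =
        (if x s = z.1 then 1 else 0) * if x t = z.2 then 1 else 0 := fun x => by
      by_cases h1 : x s = z.1 <;> by_cases h2 : x t = z.2 <;> simp [Prod.ext_iff, h1, h2]
    simp only [h2, h]
    simp [mul_comm]

end Codewords

section Ensemble

variable {ι : Type*} [Fintype ι] [DecidableEq ι] {A : ι → Type*} [∀ j, Fintype (A j)]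
  [∀ j, DecidableEq (A j)] {K : ι → Type*} [∀ j, Fintype (K j)] [∀ j, DecidableEq (K j)]

/-- The weight of a codebook whose codewords are independent, those of user `j` with law
`P j`. -/
def bookW (P : ∀ j, A j → ℝ) (c : ∀ j, K j → A j) : ℝ := ∏ j, ∏ k, P j (c j k)

lemma bookW_nonneg {P : ∀ j, A j → ℝ} (hP : ∀ j a, 0 ≤ P j a) (c : ∀ j, K j → A j) :
    0 ≤ bookW P c :=
  Finset.prod_nonneg fun j _ => Finset.prod_nonneg fun _ _ => hP j _

/-- The set of users on which two message tuples agree. -/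
def agreeSet (m m' : ∀ j, K j) : Finset ι := Finset.univ.filter fun j => m j = m' j

lemma sum_bookW_pair {P : ∀ j, A j → ℝ} (hP : ∀ j, IsPMF (P j)) (m m' : ∀ j, K j)
    (F : (∀ j, A j) → (∀ j, A j) → ℝ) :
    ∑ c : ∀ j, K j → A j, bookW P c * F (fun j => c j (m j)) (fun j => c j (m' j)) =
      ∑ u, ∑ u', prodW P u * prodW P u' * F u ((agreeSet m m').piecewise u u') := by
  have h := sum_prodW_pushforward (Z := fun j => A j × A j)
    (fun j (x : K j → A j) => ∏ k, P j (x k)) (fun j (z : A j × A j) => P j z.1 * P j z.2)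
    (fun j x => (x (m j), x (m' j))) (fun j z => (z.1, if m j = m' j then z.1 else z.2))
    (fun j f => sum_prod_mul_pair (hP j) (m j) (m' j) f)
    (fun z => F (fun j => (z j).1) (fun j => (z j).2))
  simp only at h
  refine (Eq.trans ?_ h).trans ?_
  · rfl
  · rw [← Fintype.sum_prod_type']
    refine Fintype.sum_equiv
      { toFun := fun z => (fun j => (z j).1, fun j => (z j).2)
        invFun := fun z j => (z.1 j, z.2 j)
        left_inv := fun _ => rfl
        right_inv := fun _ => rfl } _ _ fun z => ?_
    simp only [prodW, Finset.prod_mul_distrib, Equiv.coe_fn_mk]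
    congr 2
    funext j
    simp [agreeSet, Finset.piecewise]

lemma sum_bookW_single {P : ∀ j, A j → ℝ} (hP : ∀ j, IsPMF (P j)) (m : ∀ j, K j)
    (F : (∀ j, A j) → ℝ) :
    ∑ c : ∀ j, K j → A j, bookW P c * F (fun j => c j (m j)) = ∑ u, prodW P u * F u := by
  rw [sum_bookW_pair hP m m (fun u _ => F u)]
  refine Finset.sum_congr rfl fun u _ => ?_
  rw [← Finset.sum_mul, ← Finset.mul_sum, (isPMF_prodW hP).2, mul_one]

end Ensemble

section Counting

variable {ι : Type*} [Fintype ι] [DecidableEq ι] {K : ι → Type*} [∀ j, Fintype (K j)]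
  [∀ j, DecidableEq (K j)]

lemma card_agree_on (S : Finset ι) (m : ∀ j, K j) :
    (Finset.univ.filter fun m' : ∀ j, K j => ∀ j ∈ S, m j = m' j).card =
      ∏ j ∈ Sᶜ, Fintype.card (K j) := by
  have h : (Finset.univ.filter fun m' : ∀ j, K j => ∀ j ∈ S, m j = m' j) =
      Fintype.piFinset fun j => if j ∈ S then {m j} else Finset.univ := by
    ext m'
    simp only [Finset.mem_filter, Finset.mem_univ, true_and, Fintype.mem_piFinset]
    refine forall_congr' fun j => ?_
    by_cases hj : j ∈ S <;> simp [hj, eq_comm]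
  rw [h, Fintype.card_piFinset, ← Finset.prod_compl_mul_prod S]
  rw [Finset.prod_congr rfl (g := fun j => Fintype.card (K j)), Finset.prod_congr (s₁ := S) rfl
    (g := fun _ => 1)]
  · simp
  · intro j hj; simp [hj]
  · intro j hj; simp [Finset.mem_compl.1 hj]

end Counting

section LawOfLargeNumbers

variable {Z : Type*} [Fintype Z]

/-- The variance of a sum of i.i.d. random variables. -/
lemma sum_iid_sq {P : Z → ℝ} (hP : IsPMF P) (x : Z → ℝ) (hx : ∑ z, P z * x z = 0) (n : ℕ) :
    ∑ z : Fin n → Z, (∏ i, P (z i)) * (∑ i, x (z i)) ^ 2 = n * ∑ z, P z * x z ^ 2 := by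
  have h1 : ∀ z : Fin n → Z, (∏ i, P (z i)) * (∑ i, x (z i)) ^ 2 =
      ∑ i, ∑ k, (∏ i, P (z i)) * (x (z i) * x (z k)) := fun z => by
    rw [sq, Finset.sum_mul_sum, Finset.mul_sum]
    simp only [Finset.mul_sum]
  simp only [h1]
  rw [Finset.sum_comm]
  have h2 : ∀ i : Fin n, ∑ z : Fin n → Z, ∑ k, (∏ i, P (z i)) * (x (z i) * x (z k)) =
      ∑ z, P z * x z ^ 2 := fun i => by
    rw [Finset.sum_comm, Finset.sum_eq_single i]
    · rw [sum_prod_mul_coord hP i (fun a => x a * x a)]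
      simp [sq]
    · intro k _ hk
      rw [sum_prod_mul_coord_coord hP hk.symm, hx, zero_mul]
    · simp
  simp [h2]

end LawOfLargeNumbers

/-! ### A receiver of a memoryless interference network -/

section Receiver

variable {ι Q Y : Type*} [Fintype ι] [DecidableEq ι] [Fintype Q] [Fintype Y]
  {U : ι → Type*} [∀ j, Fintype (U j)]
  (pq : Q → ℝ) (p : ∀ j, Q → U j → ℝ) (V : (∀ j, U j) → Y → ℝ)

/-- The conditional law of the output given the time-sharing symbol and the inputs of the
users in `S`, the other inputs being averaged out. -/
def margV (S : Finset ι) (q : Q) (u : ∀ j, U j) (y : Y) : ℝ :=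
  ∑ u', prodW (fun j => p j q) u' * V (S.piecewise u u') y

/-- The law of a codeword of user `j` given the time-sharing sequence. -/
def wordP {n : ℕ} (q : Fin n → Q) (j : ι) (x : Fin n → U j) : ℝ := ∏ i, p j (q i) (x i)

/-- The memoryless extension of the channel. -/
def blockV {n : ℕ} (u : ∀ j, Fin n → U j) (y : Fin n → Y) : ℝ :=
  ∏ i, V (fun j => u j i) (y i)

/-- The memoryless extension of `margV`. -/
def blockMargV {n : ℕ} (S : Finset ι) (q : Fin n → Q) (u : ∀ j, Fin n → U j)
    (y : Fin n → Y) : ℝ :=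
  ∏ i, margV p V S (q i) (fun j => u j i) (y i)

/-- The single-letter joint law of the time-sharing symbol, the inputs and the output. -/
def letterP (z : Q × (∀ j, U j) × Y) : ℝ :=
  pq z.1 * prodW (fun j => p j z.1) z.2.1 * V z.2.1 z.2.2

/-- The conditional entropy (in nats) of the output given the time-sharing symbol and the
inputs of the users in `S`. -/
def condH (S : Finset ι) : ℝ :=
  -∑ z, letterP pq p V z * Real.log (margV p V S z.1 z.2.1 z.2.2)

/-- The joint law of the time-sharing sequence, the transmitted codewords and the output. -/
def blockW {n : ℕ} (q : Fin n → Q) (u : ∀ j, Fin n → U j) (y : Fin n → Y) : ℝ :=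
  (∏ i, pq (q i)) * prodW (wordP p q) u * blockV V u y

/-- Expectation with respect to `blockW`. -/
def blockE {n : ℕ} (F : (Fin n → Q) → (∀ j, Fin n → U j) → (Fin n → Y) → ℝ) : ℝ :=
  ∑ q, ∑ u, ∑ y, blockW pq p V q u y * F q u y

variable {pq p V}

lemma margV_nonneg (hp : ∀ j q, IsPMF (p j q)) (hV : ∀ u, IsPMF (V u)) (S : Finset ι) (q : Q)
    (u : ∀ j, U j) (y : Y) : 0 ≤ margV p V S q u y :=
  Finset.sum_nonneg fun u' _ =>
    mul_nonneg (prodW_nonneg (fun j a => (hp j q).1 a) u') ((hV _).1 y)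

lemma sum_margV (hp : ∀ j q, IsPMF (p j q)) (hV : ∀ u, IsPMF (V u)) (S : Finset ι) (q : Q)
    (u : ∀ j, U j) : ∑ y, margV p V S q u y = 1 := by
  simp only [margV]
  rw [Finset.sum_comm]
  simp only [← Finset.mul_sum, (hV _).2, mul_one]
  exact (isPMF_prodW fun j => hp j q).2

lemma margV_congr (S : Finset ι) (q : Q) {u v : ∀ j, U j} (h : ∀ j ∈ S, u j = v j) (y : Y) :
    margV p V S q u y = margV p V S q v y := by
  simp only [margV]
  refine Finset.sum_congr rfl fun u' _ => ?_
  rw [Finset.piecewise_congr S h fun _ _ => rfl]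

lemma prodW_mul_le_margV (hp : ∀ j q, IsPMF (p j q)) (hV : ∀ u, IsPMF (V u)) (S : Finset ι)
    (q : Q) (u : ∀ j, U j) (y : Y) :
    prodW (fun j => p j q) u * V u y ≤ margV p V S q u y := by
  have h := Finset.single_le_sum
    (f := fun u' => prodW (fun j => p j q) u' * V (S.piecewise u u') y)
    (fun u' _ => mul_nonneg (prodW_nonneg (fun j a => (hp j q).1 a) u') ((hV _).1 y))
    (Finset.mem_univ u)
  simpa [margV, Finset.piecewise_same] using h

lemma letterP_nonneg (hq : IsPMF pq) (hp : ∀ j q, IsPMF (p j q)) (hV : ∀ u, IsPMF (V u))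
    (z : Q × (∀ j, U j) × Y) : 0 ≤ letterP pq p V z :=
  mul_nonneg (mul_nonneg (hq.1 _) (prodW_nonneg (fun j a => (hp j _).1 a) _)) ((hV _).1 _)

lemma isPMF_letterP (hq : IsPMF pq) (hp : ∀ j q, IsPMF (p j q)) (hV : ∀ u, IsPMF (V u)) :
    IsPMF (letterP pq p V) := by
  refine ⟨letterP_nonneg hq hp hV, ?_⟩
  simp only [Fintype.sum_prod_type, letterP]
  simp only [← Finset.mul_sum, (hV _).2, mul_one, (isPMF_prodW fun j => hp j _).2, hq.2]

lemma margV_pos (hq : IsPMF pq) (hp : ∀ j q, IsPMF (p j q)) (hV : ∀ u, IsPMF (V u))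
    {z : Q × (∀ j, U j) × Y} (hz : 0 < letterP pq p V z) (S : Finset ι) :
    0 < margV p V S z.1 z.2.1 z.2.2 := by
  refine lt_of_lt_of_le ?_ (prodW_mul_le_margV hp hV S z.1 z.2.1 z.2.2)
  rw [letterP, mul_assoc] at hz
  exact pos_of_mul_pos_right hz (hq.1 _)

/-- Averaging `margV` over the inputs outside `T`. -/
lemma sum_prodW_margV_piecewise (hp : ∀ j q, IsPMF (p j q)) (S T : Finset ι) (q : Q)
    (u : ∀ j, U j) (y : Y) :
    ∑ u', prodW (fun j => p j q) u' * margV p V S q (T.piecewise u u') y =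
      margV p V (S ∩ T) q u y := by
  have h := sum_sum_prodW_piecewise_left (fun j => hp j q) S
    (fun v => V ((S ∩ T).piecewise u v) y)
  simp only [margV, Finset.mul_sum]
  rw [← h]
  refine Finset.sum_congr rfl fun u' _ => Finset.sum_congr rfl fun u'' _ => ?_
  rw [mul_assoc]
  congr 3
  funext j
  by_cases hS : j ∈ S <;> by_cases hT : j ∈ T <;> simp [Finset.piecewise, hS, hT]

lemma isPMF_wordP (hp : ∀ j q, IsPMF (p j q)) {n : ℕ} (q : Fin n → Q) (j : ι) :
    IsPMF (wordP p q j) :=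
  isPMF_prodW (A := fun _ : Fin n => U j) fun i => hp j (q i)

lemma sum_prodW_wordP_mul_prod {n : ℕ} (q : Fin n → Q) (f : Fin n → (∀ j, U j) → ℝ) :
    ∑ u, prodW (wordP p q) u * ∏ i, f i (fun j => u j i) =
      ∏ i, ∑ v, prodW (fun j => p j (q i)) v * f i v := by
  rw [Fintype.prod_sum]
  refine Fintype.sum_equiv (Equiv.piComm fun j (_ : Fin n) => U j) _ _ fun u => ?_
  simp only [prodW, wordP, Finset.prod_mul_distrib]
  rw [Finset.prod_comm]
  rfl

lemma sum_prodW_blockV_piecewise {n : ℕ} (T : Finset ι) (q : Fin n → Q)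
    (u : ∀ j, Fin n → U j) (y : Fin n → Y) :
    ∑ u', prodW (wordP p q) u' * blockV V (T.piecewise u u') y = blockMargV p V T q u y := by
  simp only [blockMargV, margV]
  rw [← sum_prodW_wordP_mul_prod q
    (fun i v => V (T.piecewise (fun j => u j i) v) (y i))]
  refine Finset.sum_congr rfl fun u' _ => ?_
  simp only [blockV]
  congr 1
  refine Finset.prod_congr rfl fun i _ => ?_
  congr 1
  funext j
  by_cases hT : j ∈ T <;> simp [hT]

lemma sum_prodW_blockMargV_piecewise (hp : ∀ j q, IsPMF (p j q)) {n : ℕ} (S T : Finset ι)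
    (q : Fin n → Q) (u : ∀ j, Fin n → U j) (y : Fin n → Y) :
    ∑ u', prodW (wordP p q) u' * blockMargV p V S q (T.piecewise u u') y =
      blockMargV p V (S ∩ T) q u y := by
  have h : blockMargV p V (S ∩ T) q u y =
      ∏ i, ∑ v, prodW (fun j => p j (q i)) v *
        margV p V S (q i) (T.piecewise (fun j => u j i) v) (y i) := by
    simp only [blockMargV, sum_prodW_margV_piecewise hp]
  rw [h, ← sum_prodW_wordP_mul_prod q
    (fun i v => margV p V S (q i) (T.piecewise (fun j => u j i) v) (y i))]
  refine Finset.sum_congr rfl fun u' _ => ?_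
  simp only [blockMargV]
  congr 1
  refine Finset.prod_congr rfl fun i _ => ?_
  congr 1
  funext j
  by_cases hT : j ∈ T <;> simp [hT]

lemma blockV_nonneg (hV : ∀ u, IsPMF (V u)) {n : ℕ} (u : ∀ j, Fin n → U j)
    (y : Fin n → Y) : 0 ≤ blockV V u y := Finset.prod_nonneg fun i _ => (hV _).1 (y i)

lemma sum_blockV (hV : ∀ u, IsPMF (V u)) {n : ℕ} (u : ∀ j, Fin n → U j) :
    ∑ y, blockV V u y = 1 :=
  (isPMF_prodW (A := fun _ : Fin n => Y) fun i => hV fun j => u j i).2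

lemma blockMargV_nonneg (hp : ∀ j q, IsPMF (p j q)) (hV : ∀ u, IsPMF (V u)) {n : ℕ}
    (S : Finset ι) (q : Fin n → Q) (u : ∀ j, Fin n → U j) (y : Fin n → Y) :
    0 ≤ blockMargV p V S q u y := Finset.prod_nonneg fun _ _ => margV_nonneg hp hV S _ _ _

lemma sum_blockMargV (hp : ∀ j q, IsPMF (p j q)) (hV : ∀ u, IsPMF (V u)) {n : ℕ}
    (S : Finset ι) (q : Fin n → Q) (u : ∀ j, Fin n → U j) :
    ∑ y, blockMargV p V S q u y = 1 :=
  (isPMF_prodW (A := fun _ : Fin n => Y) (P := fun i => margV p V S (q i) fun j => u j i)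
    fun _ => ⟨margV_nonneg hp hV S _ _, sum_margV hp hV S _ _⟩).2

lemma blockMargV_congr {n : ℕ} (S : Finset ι) (q : Fin n → Q) {u v : ∀ j, Fin n → U j}
    (h : ∀ j ∈ S, u j = v j) (y : Fin n → Y) :
    blockMargV p V S q u y = blockMargV p V S q v y :=
  Finset.prod_congr rfl fun i _ => margV_congr S _ (fun j hj => by rw [h j hj]) _

lemma blockW_eq_prod {n : ℕ} (q : Fin n → Q) (u : ∀ j, Fin n → U j) (y : Fin n → Y) :
    blockW pq p V q u y = ∏ i, letterP pq p V (q i, (fun j => u j i), y i) := by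
  simp only [blockW, letterP, blockV, prodW, wordP, Finset.prod_mul_distrib]
  congr 2
  rw [Finset.prod_comm]

lemma blockW_nonneg (hq : IsPMF pq) (hp : ∀ j q, IsPMF (p j q)) (hV : ∀ u, IsPMF (V u))
    {n : ℕ} (q : Fin n → Q) (u : ∀ j, Fin n → U j) (y : Fin n → Y) :
    0 ≤ blockW pq p V q u y := by
  rw [blockW_eq_prod]
  exact Finset.prod_nonneg fun i _ => letterP_nonneg hq hp hV _

lemma letterP_pos_of_blockW_pos (hq : IsPMF pq) (hp : ∀ j q, IsPMF (p j q))
    (hV : ∀ u, IsPMF (V u)) {n : ℕ} {q : Fin n → Q} {u : ∀ j, Fin n → U j} {y : Fin n → Y}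
    (h : 0 < blockW pq p V q u y) (i : Fin n) :
    0 < letterP pq p V (q i, (fun j => u j i), y i) := by
  rw [blockW_eq_prod] at h
  refine lt_of_le_of_ne (letterP_nonneg hq hp hV _) fun h0 => h.ne' ?_
  exact Finset.prod_eq_zero (Finset.mem_univ i) h0.symm

lemma blockMargV_pos (hq : IsPMF pq) (hp : ∀ j q, IsPMF (p j q)) (hV : ∀ u, IsPMF (V u))
    {n : ℕ} {q : Fin n → Q} {u : ∀ j, Fin n → U j} {y : Fin n → Y}
    (h : 0 < blockW pq p V q u y) (S : Finset ι) : 0 < blockMargV p V S q u y :=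
  Finset.prod_pos fun i _ =>
    margV_pos hq hp hV (letterP_pos_of_blockW_pos hq hp hV h i) S

lemma log_blockMargV (hq : IsPMF pq) (hp : ∀ j q, IsPMF (p j q)) (hV : ∀ u, IsPMF (V u))
    {n : ℕ} {q : Fin n → Q} {u : ∀ j, Fin n → U j} {y : Fin n → Y}
    (h : 0 < blockW pq p V q u y) (S : Finset ι) :
    Real.log (blockMargV p V S q u y) =
      ∑ i, Real.log (margV p V S (q i) (fun j => u j i) (y i)) :=
  Real.log_prod fun i _ =>
    (margV_pos hq hp hV (letterP_pos_of_blockW_pos hq hp hV h i) S).ne'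

lemma blockE_mono (hq : IsPMF pq) (hp : ∀ j q, IsPMF (p j q)) (hV : ∀ u, IsPMF (V u)) {n : ℕ}
    {F G : (Fin n → Q) → (∀ j, Fin n → U j) → (Fin n → Y) → ℝ}
    (h : ∀ q u y, 0 < blockW pq p V q u y → F q u y ≤ G q u y) :
    blockE pq p V F ≤ blockE pq p V G := by
  refine Finset.sum_le_sum fun q _ => Finset.sum_le_sum fun u _ => Finset.sum_le_sum fun y _ => ?_
  rcases (blockW_nonneg hq hp hV q u y).eq_or_lt with h0 | h0
  · simp [← h0]
  · exact mul_le_mul_of_nonneg_left (h q u y h0) h0.le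

lemma blockE_congr (hq : IsPMF pq) (hp : ∀ j q, IsPMF (p j q)) (hV : ∀ u, IsPMF (V u)) {n : ℕ}
    {F G : (Fin n → Q) → (∀ j, Fin n → U j) → (Fin n → Y) → ℝ}
    (h : ∀ q u y, 0 < blockW pq p V q u y → F q u y = G q u y) :
    blockE pq p V F = blockE pq p V G :=
  le_antisymm (blockE_mono hq hp hV fun q u y h0 => (h q u y h0).le)
    (blockE_mono hq hp hV fun q u y h0 => (h q u y h0).ge)

lemma blockE_add {n : ℕ} (F G : (Fin n → Q) → (∀ j, Fin n → U j) → (Fin n → Y) → ℝ) :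
    blockE pq p V (fun q u y => F q u y + G q u y) = blockE pq p V F + blockE pq p V G := by
  simp only [blockE, mul_add, Finset.sum_add_distrib]

lemma blockE_const_mul {n : ℕ} (a : ℝ)
    (F : (Fin n → Q) → (∀ j, Fin n → U j) → (Fin n → Y) → ℝ) :
    blockE pq p V (fun q u y => a * F q u y) = a * blockE pq p V F := by
  simp only [blockE, Finset.mul_sum, mul_left_comm]

lemma blockE_sum {n : ℕ} {κ : Type*} (s : Finset κ)
    (F : κ → (Fin n → Q) → (∀ j, Fin n → U j) → (Fin n → Y) → ℝ) :
    blockE pq p V (fun q u y => ∑ k ∈ s, F k q u y) = ∑ k ∈ s, blockE pq p V (F k) := by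
  classical
  induction s using Finset.induction_on with
  | empty => simp [blockE]
  | insert a s ha ih => simp only [Finset.sum_insert ha, blockE_add, ih]

/-- Under `blockW` the letters are independent with law `letterP`. -/
lemma blockE_eq_sum_prod {n : ℕ} (G : (Fin n → Q × (∀ j, U j) × Y) → ℝ) :
    blockE pq p V (fun q u y => G fun i => (q i, (fun j => u j i), y i)) =
      ∑ z : Fin n → Q × (∀ j, U j) × Y, (∏ i, letterP pq p V (z i)) * G z := by
  simp only [blockE]
  have h : ∀ (H : (Fin n → Q) → (∀ j, Fin n → U j) → (Fin n → Y) → ℝ),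
      ∑ q, ∑ u, ∑ y, H q u y =
        ∑ w : (Fin n → Q) × (∀ j, Fin n → U j) × (Fin n → Y), H w.1 w.2.1 w.2.2 := fun H => by
    simp only [Fintype.sum_prod_type]
  rw [h]
  refine Fintype.sum_equiv
    { toFun := fun w i => (w.1 i, (fun j => w.2.1 j i), w.2.2 i)
      invFun := fun z => (fun i => (z i).1, fun j i => (z i).2.1 j, fun i => (z i).2.2)
      left_inv := fun _ => rfl
      right_inv := fun _ => rfl } _ _ fun w => ?_
  simp only [Equiv.coe_fn_mk, blockW_eq_prod]

lemma blockE_const (hq : IsPMF pq) (hp : ∀ j q, IsPMF (p j q)) (hV : ∀ u, IsPMF (V u)) {n : ℕ}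
    (a : ℝ) : blockE pq p V (fun (_ : Fin n → Q) _ _ => a) = a := by
  have h := blockE_eq_sum_prod (pq := pq) (p := p) (V := V) (n := n) fun _ => a
  rw [h, ← Finset.sum_mul]
  have h1 := (isPMF_prodW (A := fun _ : Fin n => Q × (∀ j, U j) × Y)
    fun _ => isPMF_letterP hq hp hV).2
  simp only [prodW] at h1
  rw [h1, one_mul]

lemma blockE_sum_letters (hq : IsPMF pq) (hp : ∀ j q, IsPMF (p j q)) (hV : ∀ u, IsPMF (V u))
    {n : ℕ} (x : Q × (∀ j, U j) × Y → ℝ) :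
    blockE pq p V (fun (q : Fin n → Q) u y => ∑ i, x (q i, (fun j => u j i), y i)) =
      n * ∑ z, letterP pq p V z * x z := by
  rw [blockE_sum]
  have h : ∀ i : Fin n, blockE pq p V (fun (q : Fin n → Q) u y =>
      x (q i, (fun j => u j i), y i)) = ∑ z, letterP pq p V z * x z := fun i => by
    rw [blockE_eq_sum_prod fun z => x (z i)]
    exact sum_prod_mul_coord (isPMF_letterP hq hp hV) i x
  simp [h]

lemma exists_blockE_sq_le (hq : IsPMF pq) (hp : ∀ j q, IsPMF (p j q))
    (hV : ∀ u, IsPMF (V u)) (x : Q × (∀ j, U j) × Y → ℝ) :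
    ∃ C : ℝ, 0 ≤ C ∧ ∀ n : ℕ, blockE pq p V (fun (q : Fin n → Q) u y =>
      (∑ i, x (q i, (fun j => u j i), y i) - n * ∑ z, letterP pq p V z * x z) ^ 2) ≤ n * C := by
  set μ := ∑ z, letterP pq p V z * x z with hμ
  have hP := isPMF_letterP hq hp hV
  refine ⟨∑ z, letterP pq p V z * (x z - μ) ^ 2,
    Finset.sum_nonneg fun z _ => mul_nonneg (hP.1 z) (sq_nonneg _), fun n => ?_⟩
  have h := sum_iid_sq hP (fun z => x z - μ) (by
    simp only [mul_sub, Finset.sum_sub_distrib, ← Finset.sum_mul, hP.2, one_mul]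
    rw [← hμ, sub_self]) n
  rw [← h]
  refine le_of_eq ?_
  rw [← blockE_eq_sum_prod fun z : Fin n → Q × (∀ j, U j) × Y => (∑ i, (x (z i) - μ)) ^ 2]
  simp [Finset.sum_sub_distrib]

end Receiver

/-! ### Random coding with joint maximum likelihood decoding -/

section Achievability

variable {ι Q Y : Type*} [Fintype ι] [DecidableEq ι] [Fintype Q] [Fintype Y]
  {U : ι → Type*} [∀ j, Fintype (U j)] [∀ j, DecidableEq (U j)]
  {K : ι → Type*} [∀ j, Fintype (K j)] [∀ j, DecidableEq (K j)]
  (pq : Q → ℝ) (p : ∀ j, Q → U j → ℝ) (V : (∀ j, U j) → Y → ℝ)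

/-- The probability, for uniform messages, that the decoder `d` errs on a message of a user
in `D`. -/
def recvPe (D : Finset ι) {n : ℕ} (c : ∀ j, K j → Fin n → U j)
    (d : (Fin n → Y) → ∀ j, K j) : ℝ :=
  (Fintype.card (∀ j, K j) : ℝ)⁻¹ * ∑ m : ∀ j, K j, ∑ y, blockV V (fun j => c j (m j)) y *
    (if ∀ j ∈ D, d y j = m j then 0 else 1)

/-- Expectation with respect to the random code ensemble. -/
def ensE {n : ℕ} (G : (Fin n → Q) → (∀ j, K j → Fin n → U j) → ℝ) : ℝ :=
  ∑ q, (∏ i, pq (q i)) * ∑ c, bookW (wordP p q) c * G q c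

/-- The information density of the users in `B`, given those in `S \ B`, is at least
`n * θ`. -/
def DenseAt (S B : Finset ι) (θ : ℝ) {n : ℕ} (q : Fin n → Q) (u : ∀ j, Fin n → U j)
    (y : Fin n → Y) : Prop :=
  0 < blockMargV p V S q u y ∧
    blockMargV p V (S \ B) q u y ≤ Real.exp (-(n * θ)) * blockMargV p V S q u y

variable {pq p V}

lemma card_agreeSet_eq_compl_le (B : Finset ι) (m : ∀ j, K j) :
    ((Finset.univ.filter fun m' : ∀ j, K j => agreeSet m m' = Bᶜ).card : ℝ) ≤
      ∏ j ∈ B, (Fintype.card (K j) : ℝ) := by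
  have h := card_agree_on Bᶜ m
  rw [compl_compl] at h
  rw [← Nat.cast_prod, ← h]
  refine Nat.cast_le.2 (Finset.card_le_card fun m' hm' => ?_)
  simp only [Finset.mem_filter, Finset.mem_univ, true_and] at hm' ⊢
  intro j hj
  rw [← hm', agreeSet] at hj
  simpa using hj

open Classical in
lemma decoding_error_le (hp : ∀ j q, IsPMF (p j q)) (hV : ∀ u, IsPMF (V u)) {D S : Finset ι}
    (hDS : D ⊆ S) (θ : Finset ι → ℝ) {n : ℕ} (q : Fin n → Q) (c : ∀ j, K j → Fin n → U j)
    (y : Fin n → Y) (m₀ m : ∀ j, K j)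
    (hmax : blockMargV p V S q (fun j => c j (m j)) y ≤
      blockMargV p V S q (fun j => c j (m₀ j)) y) :
    (if ∀ j ∈ D, m₀ j = m j then (0 : ℝ) else 1) ≤
      ∑ B ∈ S.powerset.filter (fun B => B.Nonempty ∧ ∀ j ∈ B, 1 < Fintype.card (K j)),
        ((if DenseAt p V S B (θ B) q (fun j => c j (m j)) y then 0 else 1) +
          ∑ m' ∈ Finset.univ.filter (fun m' : ∀ j, K j => agreeSet m m' = Bᶜ),
            (if DenseAt p V S B (θ B) q (fun j => c j (m j)) y then 1 else 0) *
              (blockMargV p V S q (fun j => c j (m' j)) y /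
                blockMargV p V S q (fun j => c j (m j)) y)) := by
  have hterm : ∀ B : Finset ι, ∀ m' : ∀ j, K j,
      0 ≤ (if DenseAt p V S B (θ B) q (fun j => c j (m j)) y then (1 : ℝ) else 0) *
              (blockMargV p V S q (fun j => c j (m' j)) y /
                blockMargV p V S q (fun j => c j (m j)) y) := fun B m' =>
    mul_nonneg (by split_ifs <;> norm_num)
      (div_nonneg (blockMargV_nonneg hp hV _ _ _ _) (blockMargV_nonneg hp hV _ _ _ _))
  have hB : ∀ B : Finset ι,
      0 ≤ (if DenseAt p V S B (θ B) q (fun j => c j (m j)) y then (0 : ℝ) else 1) +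
          ∑ m' ∈ Finset.univ.filter (fun m' : ∀ j, K j => agreeSet m m' = Bᶜ),
            (if DenseAt p V S B (θ B) q (fun j => c j (m j)) y then 1 else 0) *
              (blockMargV p V S q (fun j => c j (m' j)) y /
                blockMargV p V S q (fun j => c j (m j)) y) := fun B =>
    add_nonneg (by split_ifs <;> norm_num) (Finset.sum_nonneg fun m' _ => hterm B m')
  split_ifs with herr
  · exact Finset.sum_nonneg fun B _ => hB B
  push Not at herr
  obtain ⟨j₀, hj₀D, hj₀⟩ := herr
  set m' : ∀ j, K j := S.piecewise m₀ m with hm'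
  set B : Finset ι := (agreeSet m m')ᶜ with hBdef
  have hmemB : ∀ j, j ∈ B ↔ m j ≠ m' j := fun j => by simp [hBdef, agreeSet]
  have hBS : B ∈ S.powerset.filter
      (fun B => B.Nonempty ∧ ∀ j ∈ B, 1 < Fintype.card (K j)) := by
    simp only [Finset.mem_filter, Finset.mem_powerset]
    refine ⟨fun j hj => ?_, ⟨j₀, ?_⟩, fun j hj => ?_⟩
    · by_contra hjS
      exact (hmemB j).1 hj (by simp [hm', hjS])
    · rw [hmemB]
      simpa [hm', hDS hj₀D] using hj₀.symm
    · exact Fintype.one_lt_card_iff.2 ⟨_, _, (hmemB j).1 hj⟩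
  refine le_trans ?_ (Finset.single_le_sum (fun B _ => hB B) hBS)
  by_cases hG : DenseAt p V S B (θ B) q (fun j => c j (m j)) y
  · simp only [hG, if_true, zero_add, one_mul]
    have hmem : m' ∈ Finset.univ.filter (fun m' : ∀ j, K j => agreeSet m m' = Bᶜ) := by
      simp [hBdef]
    refine le_trans ?_ (Finset.single_le_sum (fun m' _ => div_nonneg
      (blockMargV_nonneg hp hV _ _ _ _) (blockMargV_nonneg hp hV _ _ _ _)) hmem)
    rw [one_le_div hG.1]
    refine hmax.trans_eq (blockMargV_congr S q (fun j hj => ?_) y)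
    simp [hm', hj]
  · simp only [hG, if_false]
    simp

open Classical in
lemma sum_bookW_error_le (hp : ∀ j q, IsPMF (p j q)) (hV : ∀ u, IsPMF (V u)) (S B : Finset ι)
    (θ : ℝ) {n : ℕ} (q : Fin n → Q) (m m' : ∀ j, K j) (hm : agreeSet m m' = Bᶜ) :
    ∑ c, bookW (wordP p q) c * ∑ y, blockV V (fun j => c j (m j)) y *
        ((if DenseAt p V S B θ q (fun j => c j (m j)) y then 1 else 0) *
          (blockMargV p V S q (fun j => c j (m' j)) y /
            blockMargV p V S q (fun j => c j (m j)) y)) ≤ Real.exp (-(n * θ)) := by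
  have hw := isPMF_wordP hp q
  have h0 : ∀ u, 0 ≤ prodW (wordP p q) u := prodW_nonneg fun j a => (hw j).1 a
  rw [sum_bookW_pair hw m m' (fun u u' => ∑ y, blockV V u y *
        ((if DenseAt p V S B θ q u y then 1 else 0) *
          (blockMargV p V S q u' y / blockMargV p V S q u y))), hm]
  calc _ = ∑ u, prodW (wordP p q) u * ∑ y, blockV V u y *
        ((if DenseAt p V S B θ q u y then 1 else 0) *
          (blockMargV p V (S \ B) q u y / blockMargV p V S q u y)) := by
        refine Finset.sum_congr rfl fun u _ => ?_
        simp only [mul_assoc, ← Finset.mul_sum]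
        congr 1
        simp only [Finset.mul_sum]
        rw [Finset.sum_comm]
        refine Finset.sum_congr rfl fun y _ => ?_
        rw [Finset.sdiff_eq_inter_compl, ← sum_prodW_blockMargV_piecewise hp, Finset.sum_div,
          Finset.mul_sum, Finset.mul_sum]
        refine Finset.sum_congr rfl fun u' _ => ?_
        ring
    _ ≤ ∑ u, prodW (wordP p q) u * ∑ y, blockV V u y * Real.exp (-(n * θ)) := by
        refine Finset.sum_le_sum fun u _ => mul_le_mul_of_nonneg_left
          (Finset.sum_le_sum fun y _ => mul_le_mul_of_nonneg_left ?_ (blockV_nonneg hV u y)) (h0 u)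
        split_ifs with hG
        · rw [one_mul, div_le_iff₀ hG.1]
          exact hG.2
        · rw [zero_mul]
          exact (Real.exp_pos _).le
    _ = _ := by
        simp only [← Finset.sum_mul, sum_blockV hV, one_mul, (isPMF_prodW hw).2]

open Classical in
/-- The error probability of joint maximum likelihood decoding of the users in `S`. -/
theorem exists_decoder_ensE_recvPe_le [∀ j, Nonempty (K j)] (hq : IsPMF pq)
    (hp : ∀ j q, IsPMF (p j q)) (hV : ∀ u, IsPMF (V u)) {D S : Finset ι} (hDS : D ⊆ S)
    (θ : Finset ι → ℝ) (n : ℕ) :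
    ∃ d : (Fin n → Q) → (∀ j, K j → Fin n → U j) → (Fin n → Y) → ∀ j, K j,
      ensE pq p (fun q c => recvPe V D c (d q c)) ≤
        ∑ B ∈ S.powerset.filter (fun B => B.Nonempty ∧ ∀ j ∈ B, 1 < Fintype.card (K j)),
          (blockE pq p V (fun (q : Fin n → Q) u y =>
              if DenseAt p V S B (θ B) q u y then 0 else 1) +
            (∏ j ∈ B, (Fintype.card (K j) : ℝ)) * Real.exp (-(n * θ B))) := by
  choose d hd using fun (q : Fin n → Q) (c : ∀ j, K j → Fin n → U j) (y : Fin n → Y) =>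
    Finite.exists_max fun m : ∀ j, K j => blockMargV p V S q (fun j => c j (m j)) y
  refine ⟨d, ?_⟩
  set 𝓑 := S.powerset.filter (fun B => B.Nonempty ∧ ∀ j ∈ B, 1 < Fintype.card (K j)) with h𝓑
  have hcard : (0 : ℝ) < Fintype.card (∀ j, K j) := Nat.cast_pos.2 Fintype.card_pos
  have hq0 : ∀ q : Fin n → Q, 0 ≤ ∏ i, pq (q i) := fun q => Finset.prod_nonneg fun i _ => hq.1 _
  have hq1 : ∑ q : Fin n → Q, ∏ i, pq (q i) = 1 :=
    (isPMF_prodW (A := fun _ : Fin n => Q) fun _ => hq).2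
  have key : ∀ q : Fin n → Q, ∑ c, bookW (wordP p q) c * recvPe V D c (d q c) ≤
      ∑ B ∈ 𝓑, (∑ u, prodW (wordP p q) u * ∑ y, blockV V u y *
          (if DenseAt p V S B (θ B) q u y then 0 else 1) +
        (∏ j ∈ B, (Fintype.card (K j) : ℝ)) * Real.exp (-(n * θ B))) := by
    intro q
    have hw := isPMF_wordP hp q
    have hb : ∀ c : ∀ j, K j → Fin n → U j, 0 ≤ bookW (wordP p q) c :=
      bookW_nonneg fun j a => (hw j).1 a
    have hm : ∀ m : ∀ j, K j, ∑ c, bookW (wordP p q) c *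
        ∑ y, blockV V (fun j => c j (m j)) y * (if ∀ j ∈ D, d q c y j = m j then 0 else 1) ≤
      ∑ B ∈ 𝓑, (∑ u, prodW (wordP p q) u * ∑ y, blockV V u y *
          (if DenseAt p V S B (θ B) q u y then 0 else 1) +
        (∏ j ∈ B, (Fintype.card (K j) : ℝ)) * Real.exp (-(n * θ B))) := by
      intro m
      calc _ ≤ ∑ c, bookW (wordP p q) c * ∑ y, blockV V (fun j => c j (m j)) y *
            ∑ B ∈ 𝓑, ((if DenseAt p V S B (θ B) q (fun j => c j (m j)) y then 0 else 1) +
              ∑ m' ∈ Finset.univ.filter (fun m' : ∀ j, K j => agreeSet m m' = Bᶜ),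
                (if DenseAt p V S B (θ B) q (fun j => c j (m j)) y then 1 else 0) *
                  (blockMargV p V S q (fun j => c j (m' j)) y /
                    blockMargV p V S q (fun j => c j (m j)) y)) := by
              refine Finset.sum_le_sum fun c _ => mul_le_mul_of_nonneg_left
                (Finset.sum_le_sum fun y _ => mul_le_mul_of_nonneg_left ?_
                  (blockV_nonneg hV _ y)) (hb c)
              exact decoding_error_le hp hV hDS θ q c y (d q c y) m (hd q c y m)
        _ = ∑ B ∈ 𝓑, (∑ c, bookW (wordP p q) c * ∑ y, blockV V (fun j => c j (m j)) y *
              (if DenseAt p V S B (θ B) q (fun j => c j (m j)) y then 0 else 1) +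
            ∑ m' ∈ Finset.univ.filter (fun m' : ∀ j, K j => agreeSet m m' = Bᶜ),
              ∑ c, bookW (wordP p q) c * ∑ y, blockV V (fun j => c j (m j)) y *
                ((if DenseAt p V S B (θ B) q (fun j => c j (m j)) y then 1 else 0) *
                  (blockMargV p V S q (fun j => c j (m' j)) y /
                    blockMargV p V S q (fun j => c j (m j)) y))) := by
              rw [Finset.sum_congr rfl fun B _ => congrArg₂ (· + ·) rfl Finset.sum_comm]
              simp only [← Finset.sum_add_distrib]
              rw [Finset.sum_comm]
              refine Finset.sum_congr rfl fun c _ => ?_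
              simp only [Finset.mul_sum, mul_add, Finset.sum_add_distrib]
              congr 1
              · rw [Finset.sum_comm]
              · rw [Finset.sum_comm]
                refine Finset.sum_congr rfl fun B _ => ?_
                rw [Finset.sum_comm]
        _ ≤ _ := by
              refine Finset.sum_le_sum fun B _ => add_le_add (le_of_eq ?_) ?_
              · exact sum_bookW_single hw m (fun u => ∑ y, blockV V u y *
                  (if DenseAt p V S B (θ B) q u y then 0 else 1))
              · refine (Finset.sum_le_card_nsmul _ _ (Real.exp (-(n * θ B)))
                  fun m' hm' => ?_).trans ?_
                · exact sum_bookW_error_le hp hV S B (θ B) q m m' (Finset.mem_filter.1 hm').2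
                · rw [nsmul_eq_mul]
                  exact mul_le_mul_of_nonneg_right (card_agreeSet_eq_compl_le B m)
                    (Real.exp_pos _).le
    have hswap : ∑ c, bookW (wordP p q) c * recvPe V D c (d q c) =
        (Fintype.card (∀ j, K j) : ℝ)⁻¹ * ∑ m : ∀ j, K j, ∑ c, bookW (wordP p q) c *
        ∑ y, blockV V (fun j => c j (m j)) y *
          (if ∀ j ∈ D, d q c y j = m j then 0 else 1) := by
      rw [Finset.sum_comm, Finset.mul_sum]
      refine Finset.sum_congr rfl fun c _ => ?_
      rw [recvPe, ← Finset.mul_sum]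
      ring
    rw [hswap, inv_mul_le_iff₀ hcard]
    refine (Finset.sum_le_card_nsmul _ _ _ fun m _ => hm m).trans ?_
    rw [nsmul_eq_mul, Finset.card_univ]
  refine (Finset.sum_le_sum fun q _ => mul_le_mul_of_nonneg_left (key q) (hq0 q)).trans
    (le_of_eq ?_)
  simp only [Finset.mul_sum, mul_add]
  rw [Finset.sum_comm]
  refine Finset.sum_congr rfl fun B _ => ?_
  rw [Finset.sum_add_distrib]
  congr 1
  · simp only [blockE, blockW, mul_assoc]
  · rw [← Finset.sum_mul, hq1, one_mul]

end Achievability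

/-! ### A Fano-type inequality for the random code ensemble -/

section Messages

variable {ι : Type*} [Fintype ι] [DecidableEq ι] {K : ι → Type*} [∀ j, Fintype (K j)]
  [∀ j, DecidableEq (K j)]

/-- The number of message tuples of the users in `S`. -/
def msgProd (K : ι → Type*) [∀ j, Fintype (K j)] (S : Finset ι) : ℝ :=
  ∏ j ∈ S, (Fintype.card (K j) : ℝ)

lemma one_le_msgProd [∀ j, Nonempty (K j)] (S : Finset ι) : 1 ≤ msgProd K S := by
  rw [msgProd, ← Nat.cast_prod, Nat.one_le_cast]
  exact Finset.prod_pos fun _ _ => Fintype.card_pos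

lemma msgProd_pos [∀ j, Nonempty (K j)] (S : Finset ι) : 0 < msgProd K S :=
  one_pos.trans_le (one_le_msgProd S)

lemma msgProd_mul_compl (S : Finset ι) :
    msgProd K S * msgProd K Sᶜ = Fintype.card (∀ j, K j) := by
  rw [msgProd, msgProd, Finset.prod_mul_prod_compl, Fintype.card_pi, Nat.cast_prod]

lemma sum_agree_on (S : Finset ι) (m : ∀ j, K j) :
    ∑ m' : ∀ j, K j, (if ∀ j ∈ S, m j = m' j then (1 : ℝ) else 0) = msgProd K Sᶜ := by
  rw [Finset.sum_boole, card_agree_on, Nat.cast_prod, msgProd]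

lemma sum_mul_eq_sum_average_mul [∀ j, Nonempty (K j)] (D : Finset ι) (f k : (∀ j, K j) → ℝ)
    (hk : ∀ m m', k (D.piecewise m m') = k m) :
    ∑ m, f m * k m =
      ∑ m, ((Fintype.card (∀ j, K j) : ℝ)⁻¹ * ∑ m', f (D.piecewise m m')) * k m := by
  have hcard : (Fintype.card (∀ j, K j) : ℝ) ≠ 0 := Nat.cast_ne_zero.2 Fintype.card_ne_zero
  have h := sum_sum_piecewise_swap D fun m (_ : ∀ j, K j) => f m * k m
  simp only [Finset.sum_const, Finset.card_univ, nsmul_eq_mul, ← Finset.mul_sum, hk] at h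
  simp only [mul_assoc, ← Finset.mul_sum, Finset.sum_mul]
  rw [h, inv_mul_cancel_left₀ hcard]

lemma sum_mul_of_piecewise [∀ j, Nonempty (K j)] (A : Finset ι) (f g : (∀ j, K j) → ℝ)
    (hf : ∀ m m', f (A.piecewise m m') = f m) (hg : ∀ m m', g (A.piecewise m m') = g m') :
    ∑ m, f m * g m = (Fintype.card (∀ j, K j) : ℝ)⁻¹ * ((∑ m, f m) * ∑ m, g m) := by
  have hcard : (Fintype.card (∀ j, K j) : ℝ) ≠ 0 := Nat.cast_ne_zero.2 Fintype.card_ne_zero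
  have h := sum_sum_piecewise_swap A fun m (_ : ∀ j, K j) => f m * g m
  simp only [Finset.sum_const, Finset.card_univ, nsmul_eq_mul, ← Finset.mul_sum, hf, hg] at h
  rw [← Finset.sum_mul] at h
  rw [h, inv_mul_cancel_left₀ hcard]

end Messages

section Fano

variable {ι Q Y : Type*} [Fintype ι] [DecidableEq ι] [Fintype Q] [Fintype Y]
  {U : ι → Type*} [∀ j, Fintype (U j)] [∀ j, DecidableEq (U j)]
  {K : ι → Type*} [∀ j, Fintype (K j)] [∀ j, DecidableEq (K j)]
  (pq : Q → ℝ) (p : ∀ j, Q → U j → ℝ) (V : (∀ j, U j) → Y → ℝ)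

/-- The joint law of the codebook, the messages and the output. -/
def fullW {n : ℕ} (q : Fin n → Q) (c : ∀ j, K j → Fin n → U j) (m : ∀ j, K j)
    (y : Fin n → Y) : ℝ :=
  (∏ i, pq (q i)) * bookW (wordP p q) c * (Fintype.card (∀ j, K j) : ℝ)⁻¹ *
    blockV V (fun j => c j (m j)) y

/-- Expectation with respect to `fullW`. -/
def fullE {n : ℕ}
    (F : (Fin n → Q) → (∀ j, K j → Fin n → U j) → (∀ j, K j) → (Fin n → Y) → ℝ) : ℝ :=
  ∑ q, ∑ c, ∑ m, ∑ y, fullW pq p V q c m y * F q c m y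

/-- The law of the output given the codebook and the messages of the users in `D`. -/
def demandV (D : Finset ι) {n : ℕ} (c : ∀ j, K j → Fin n → U j) (m : ∀ j, K j)
    (y : Fin n → Y) : ℝ :=
  (Fintype.card (∀ j, K j) : ℝ)⁻¹ *
    ∑ m', blockV V (fun j => c j (D.piecewise m m' j)) y

/-- The conditional expectation of `demandV` given the transmitted codewords, up to the
factors `1 - 1 / card (K j)`. -/
def mixV (K : ι → Type*) [∀ j, Fintype (K j)] (D : Finset ι) {n : ℕ} (q : Fin n → Q)
    (u : ∀ j, Fin n → U j) (y : Fin n → Y) : ℝ :=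
  ∑ S ∈ Dᶜ.powerset, (msgProd K S)⁻¹ * blockMargV p V (D ∪ S) q u y

/-- The test law of the messages of the users in `A`, relative to the uniform law: it mixes
the output `m₀` of a decoder with the uniform law. -/
def testMsg (A : Finset ι) (m₀ m : ∀ j, K j) : ℝ :=
  (msgProd K A * (if ∀ j ∈ A, m₀ j = m j then 1 else 0) + 1) / 2

/-- The test law of the output given the messages of the users in `T`. -/
def testV (T S' : Finset ι) {n : ℕ} (q : Fin n → Q) (c : ∀ j, K j → Fin n → U j)
    (m : ∀ j, K j) (y : Fin n → Y) : ℝ :=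
  (Fintype.card (∀ j, K j) : ℝ)⁻¹ *
    ∑ m', blockMargV p V (T ∪ S') q (fun j => c j (T.piecewise m m' j)) y

variable {pq p V}

lemma fullW_nonneg (hq : IsPMF pq) (hp : ∀ j q, IsPMF (p j q)) (hV : ∀ u, IsPMF (V u))
    {n : ℕ} (q : Fin n → Q) (c : ∀ j, K j → Fin n → U j) (m : ∀ j, K j) (y : Fin n → Y) :
    0 ≤ fullW pq p V q c m y :=
  mul_nonneg (mul_nonneg (mul_nonneg (Finset.prod_nonneg fun _ _ => hq.1 _)
    (bookW_nonneg (fun j a => (isPMF_wordP hp q j).1 a) c)) (inv_nonneg.2 (Nat.cast_nonneg _)))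
    (blockV_nonneg hV _ y)

lemma blockW_pos_of_fullW_pos (hq : IsPMF pq) (hp : ∀ j q, IsPMF (p j q))
    (hV : ∀ u, IsPMF (V u)) {n : ℕ} {q : Fin n → Q} {c : ∀ j, K j → Fin n → U j}
    {m : ∀ j, K j} {y : Fin n → Y} (h : 0 < fullW pq p V q c m y) :
    0 < blockW pq p V q (fun j => c j (m j)) y := by
  refine lt_of_le_of_ne (blockW_nonneg hq hp hV _ _ _) fun h0 => h.ne' ?_
  rw [blockW] at h0
  rcases mul_eq_zero.1 h0.symm with h1 | h1
  · rcases mul_eq_zero.1 h1 with h2 | h2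
    · simp [fullW, h2]
    · have : bookW (wordP p q) c = 0 := by
        obtain ⟨j, hj, hj0⟩ := Finset.prod_eq_zero_iff.1 h2
        exact Finset.prod_eq_zero hj (Finset.prod_eq_zero (Finset.mem_univ (m j)) hj0)
      simp [fullW, this]
  · simp [fullW, h1]

lemma fullE_mono (hq : IsPMF pq) (hp : ∀ j q, IsPMF (p j q)) (hV : ∀ u, IsPMF (V u)) {n : ℕ}
    {F G : (Fin n → Q) → (∀ j, K j → Fin n → U j) → (∀ j, K j) → (Fin n → Y) → ℝ}
    (h : ∀ q c m y, 0 < fullW pq p V q c m y → F q c m y ≤ G q c m y) :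
    fullE pq p V F ≤ fullE pq p V G := by
  refine Finset.sum_le_sum fun q _ => Finset.sum_le_sum fun c _ =>
    Finset.sum_le_sum fun m _ => Finset.sum_le_sum fun y _ => ?_
  rcases (fullW_nonneg hq hp hV q c m y).eq_or_lt with h0 | h0
  · simp [← h0]
  · exact mul_le_mul_of_nonneg_left (h q c m y h0) h0.le

lemma fullE_add {n : ℕ}
    (F G : (Fin n → Q) → (∀ j, K j → Fin n → U j) → (∀ j, K j) → (Fin n → Y) → ℝ) :
    fullE pq p V (fun q c m y => F q c m y + G q c m y) =
      fullE pq p V F + fullE pq p V G := by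
  simp only [fullE, mul_add, Finset.sum_add_distrib]

lemma fullE_const_mul {n : ℕ} (a : ℝ)
    (F : (Fin n → Q) → (∀ j, K j → Fin n → U j) → (∀ j, K j) → (Fin n → Y) → ℝ) :
    fullE pq p V (fun q c m y => a * F q c m y) = a * fullE pq p V F := by
  simp only [fullE, Finset.mul_sum, mul_left_comm]

lemma fullE_eq_ensE {n : ℕ}
    (F : (Fin n → Q) → (∀ j, K j → Fin n → U j) → (∀ j, K j) → (Fin n → Y) → ℝ) :
    fullE pq p V F = ensE pq p fun q c => (Fintype.card (∀ j, K j) : ℝ)⁻¹ *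
      ∑ m, ∑ y, blockV V (fun j => c j (m j)) y * F q c m y := by
  simp only [fullE, ensE, fullW, Finset.mul_sum, mul_assoc]

lemma fullE_eq_average {n : ℕ}
    (F : (Fin n → Q) → (∀ j, K j → Fin n → U j) → (∀ j, K j) → (Fin n → Y) → ℝ) :
    fullE pq p V F = ∑ q, (∏ i, pq (q i)) * ((Fintype.card (∀ j, K j) : ℝ)⁻¹ *
      ∑ m, ∑ c, bookW (wordP p q) c *
        ∑ y, blockV V (fun j => c j (m j)) y * F q c m y) := by
  simp only [fullE, fullW]
  refine Finset.sum_congr rfl fun q _ => ?_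
  rw [Finset.sum_comm]
  simp only [Finset.mul_sum]
  refine Finset.sum_congr rfl fun m _ => Finset.sum_congr rfl fun c _ =>
    Finset.sum_congr rfl fun y _ => ?_
  ring

lemma fullE_eq_blockE [∀ j, Nonempty (K j)] (hp : ∀ j q, IsPMF (p j q)) {n : ℕ}
    (F : (Fin n → Q) → (∀ j, Fin n → U j) → (Fin n → Y) → ℝ) :
    fullE (K := K) pq p V (fun q c m y => F q (fun j => c j (m j)) y) = blockE pq p V F := by
  have hcard : (Fintype.card (∀ j, K j) : ℝ) ≠ 0 := Nat.cast_ne_zero.2 Fintype.card_ne_zero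
  rw [fullE_eq_average]
  simp only [blockE, blockW, mul_assoc, ← Finset.mul_sum]
  refine Finset.sum_congr rfl fun q _ => ?_
  congr 1
  have h : ∀ m : ∀ j, K j, ∑ c, bookW (wordP p q) c *
      ∑ y, blockV V (fun j => c j (m j)) y * F q (fun j => c j (m j)) y =
      ∑ u, prodW (wordP p q) u * ∑ y, blockV V u y * F q u y := fun m =>
    sum_bookW_single (isPMF_wordP hp q) m fun u => ∑ y, blockV V u y * F q u y
  simp only [h, Finset.sum_const, Finset.card_univ, nsmul_eq_mul]
  rw [inv_mul_cancel_left₀ hcard]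

lemma mixV_nonneg [∀ j, Nonempty (K j)] (hp : ∀ j q, IsPMF (p j q)) (hV : ∀ u, IsPMF (V u))
    (D : Finset ι) {n : ℕ} (q : Fin n → Q) (u : ∀ j, Fin n → U j) (y : Fin n → Y) :
    0 ≤ mixV p V K D q u y :=
  Finset.sum_nonneg fun S _ =>
    mul_nonneg (inv_nonneg.2 (msgProd_pos S).le) (blockMargV_nonneg hp hV _ _ _ _)

lemma average_blockMargV_agreeSet_le [∀ j, Nonempty (K j)] (hp : ∀ j q, IsPMF (p j q))
    (hV : ∀ u, IsPMF (V u)) (D : Finset ι) {n : ℕ} (q : Fin n → Q) (m : ∀ j, K j)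
    (u : ∀ j, Fin n → U j) (y : Fin n → Y) :
    (Fintype.card (∀ j, K j) : ℝ)⁻¹ *
      ∑ m', blockMargV p V (agreeSet m (D.piecewise m m')) q u y ≤ mixV p V K D q u y := by
  have hcard : (0 : ℝ) < Fintype.card (∀ j, K j) := Nat.cast_pos.2 Fintype.card_pos
  rw [inv_mul_le_iff₀ hcard, mixV, Finset.mul_sum]
  have h1 : ∀ m' : ∀ j, K j, blockMargV p V (agreeSet m (D.piecewise m m')) q u y ≤
      ∑ S ∈ Dᶜ.powerset, (if ∀ j ∈ S, m j = m' j then (1 : ℝ) else 0) *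
        blockMargV p V (D ∪ S) q u y := by
    intro m'
    have hmem : agreeSet m m' \ D ∈ Dᶜ.powerset := by
      rw [Finset.mem_powerset]
      exact fun j hj => Finset.mem_compl.2 (Finset.mem_sdiff.1 hj).2
    refine le_trans (le_of_eq ?_) (Finset.single_le_sum (fun S _ => mul_nonneg
      (by split_ifs <;> norm_num) (blockMargV_nonneg hp hV _ _ _ _)) hmem)
    rw [if_pos, one_mul]
    · congr 1
      ext j
      by_cases hj : j ∈ D <;> simp [agreeSet, hj]
    · intro j hj
      simpa [agreeSet] using (Finset.mem_sdiff.1 hj).1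
  refine (Finset.sum_le_sum fun m' _ => h1 m').trans (le_of_eq ?_)
  rw [Finset.sum_comm]
  refine Finset.sum_congr rfl fun S _ => ?_
  rw [← Finset.sum_mul, sum_agree_on, ← msgProd_mul_compl S, ← mul_assoc]
  have := (msgProd_pos (K := K) S).ne'
  field_simp

lemma fullE_demandV_div_mixV_le [∀ j, Nonempty (K j)] (hq : IsPMF pq)
    (hp : ∀ j q, IsPMF (p j q)) (hV : ∀ u, IsPMF (V u)) (D : Finset ι) (n : ℕ) :
    fullE (K := K) pq p V (fun (q : Fin n → Q) c m y =>
      demandV V D c m y / mixV p V K D q (fun j => c j (m j)) y) ≤ 1 := by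
  have hcard : (0 : ℝ) < Fintype.card (∀ j, K j) := Nat.cast_pos.2 Fintype.card_pos
  have hq1 : ∑ q : Fin n → Q, ∏ i, pq (q i) = 1 :=
    (isPMF_prodW (A := fun _ : Fin n => Q) fun _ => hq).2
  rw [fullE_eq_average, ← hq1]
  refine Finset.sum_le_sum fun q _ => mul_le_of_le_one_right
    (Finset.prod_nonneg fun i _ => hq.1 _) ?_
  rw [inv_mul_le_iff₀ hcard, mul_one]
  have hw := isPMF_wordP hp q
  have key : ∀ m : ∀ j, K j, ∑ c, bookW (wordP p q) c *
      ∑ y, blockV V (fun j => c j (m j)) y *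
        (demandV V D c m y / mixV p V K D q (fun j => c j (m j)) y) ≤ 1 := by
    intro m
    have h1 : ∑ c, bookW (wordP p q) c * ∑ y, blockV V (fun j => c j (m j)) y *
        (demandV V D c m y / mixV p V K D q (fun j => c j (m j)) y) =
      (Fintype.card (∀ j, K j) : ℝ)⁻¹ * ∑ m', ∑ c, bookW (wordP p q) c *
        ∑ y, blockV V (fun j => c j (m j)) y *
          (blockV V (fun j => c j (D.piecewise m m' j)) y /
            mixV p V K D q (fun j => c j (m j)) y) := by
      rw [Finset.sum_comm, Finset.mul_sum]
      refine Finset.sum_congr rfl fun c _ => ?_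
      rw [← Finset.mul_sum, Finset.sum_comm, mul_left_comm]
      congr 1
      rw [Finset.mul_sum]
      refine Finset.sum_congr rfl fun y _ => ?_
      rw [demandV, ← Finset.mul_sum, ← Finset.sum_div]
      ring
    have h2 : ∀ m' : ∀ j, K j, ∑ c, bookW (wordP p q) c *
        ∑ y, blockV V (fun j => c j (m j)) y *
          (blockV V (fun j => c j (D.piecewise m m' j)) y /
            mixV p V K D q (fun j => c j (m j)) y) =
        ∑ u, prodW (wordP p q) u * ∑ y, blockV V u y *
          (blockMargV p V (agreeSet m (D.piecewise m m')) q u y / mixV p V K D q u y) := by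
      intro m'
      rw [sum_bookW_pair hw m (D.piecewise m m') (fun u u' => ∑ y, blockV V u y *
        (blockV V u' y / mixV p V K D q u y))]
      refine Finset.sum_congr rfl fun u _ => ?_
      simp only [mul_assoc, ← Finset.mul_sum]
      congr 1
      simp only [Finset.mul_sum]
      rw [Finset.sum_comm]
      refine Finset.sum_congr rfl fun y _ => ?_
      rw [← sum_prodW_blockV_piecewise, Finset.sum_div, Finset.mul_sum]
      refine Finset.sum_congr rfl fun u' _ => ?_
      ring
    rw [h1]
    simp only [h2]
    rw [Finset.sum_comm, Finset.mul_sum, ← (isPMF_prodW hw).2]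
    refine Finset.sum_le_sum fun u _ => ?_
    rw [← Finset.mul_sum, mul_left_comm]
    refine mul_le_of_le_one_right (prodW_nonneg (fun j a => (hw j).1 a) u) ?_
    rw [Finset.sum_comm, Finset.mul_sum, ← sum_blockV hV u]
    refine Finset.sum_le_sum fun y _ => ?_
    rw [← Finset.mul_sum, mul_left_comm]
    refine mul_le_of_le_one_right (blockV_nonneg hV u y) ?_
    rw [← Finset.sum_div, ← mul_div_assoc]
    exact div_le_one_of_le₀ (average_blockMargV_agreeSet_le hp hV D q m u y)
      (mixV_nonneg hp hV D q u y)
  refine (Finset.sum_le_card_nsmul _ _ 1 fun m _ => key m).trans ?_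
  simp

lemma testMsg_pos [∀ j, Nonempty (K j)] (A : Finset ι) (m₀ m : ∀ j, K j) :
    0 < testMsg A m₀ m := by
  have := msgProd_pos (K := K) A
  unfold testMsg
  split_ifs <;> positivity

lemma sum_testMsg (A : Finset ι) (m₀ : ∀ j, K j) :
    ∑ m, testMsg A m₀ m = Fintype.card (∀ j, K j) := by
  simp only [testMsg]
  rw [← Finset.sum_div, Finset.sum_add_distrib, ← Finset.mul_sum, sum_agree_on,
    msgProd_mul_compl]
  simp

lemma le_log_testMsg [∀ j, Nonempty (K j)] {A D : Finset ι} (hAD : A ⊆ D) (m₀ m : ∀ j, K j) :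
    (1 - (if ∀ j ∈ D, m₀ j = m j then 0 else 1)) * Real.log (msgProd K A) - Real.log 2 ≤
      Real.log (testMsg A m₀ m) := by
  have hA := msgProd_pos (K := K) A
  split_ifs with h
  · rw [testMsg, if_pos fun j hj => h j (hAD hj), Real.log_div (by positivity) two_ne_zero]
    have := Real.log_le_log hA (show msgProd K A ≤ msgProd K A * 1 + 1 by linarith)
    linarith
  · have h1 : (2 : ℝ)⁻¹ ≤ testMsg A m₀ m := by
      unfold testMsg
      split_ifs <;> linarith
    have := Real.log_le_log (by norm_num) h1
    rw [Real.log_inv] at this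
    linarith

lemma le_testV [∀ j, Nonempty (K j)] (hp : ∀ j q, IsPMF (p j q)) (hV : ∀ u, IsPMF (V u))
    (T S' : Finset ι) {n : ℕ} (q : Fin n → Q) (c : ∀ j, K j → Fin n → U j) (m : ∀ j, K j)
    (y : Fin n → Y) :
    (msgProd K S')⁻¹ * blockMargV p V (T ∪ S') q (fun j => c j (m j)) y ≤
      testV p V T S' q c m y := by
  have hcard : (0 : ℝ) < Fintype.card (∀ j, K j) := Nat.cast_pos.2 Fintype.card_pos
  rw [testV, le_inv_mul_iff₀ hcard, ← msgProd_mul_compl S']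
  have h : msgProd K S' * msgProd K S'ᶜ *
      ((msgProd K S')⁻¹ * blockMargV p V (T ∪ S') q (fun j => c j (m j)) y) =
      ∑ m' : ∀ j, K j, (if ∀ j ∈ S', m j = m' j then (1 : ℝ) else 0) *
        blockMargV p V (T ∪ S') q (fun j => c j (m j)) y := by
    rw [← Finset.sum_mul, sum_agree_on]
    have := (msgProd_pos (K := K) S').ne'
    field_simp
  rw [h]
  refine Finset.sum_le_sum fun m' _ => ?_
  split_ifs with hm
  · rw [one_mul]
    refine le_of_eq (blockMargV_congr _ _ (fun j hj => ?_) _)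
    by_cases hjT : j ∈ T
    · simp [hjT]
    · simp [hjT, hm j ((Finset.mem_union.1 hj).resolve_left hjT)]
  · rw [zero_mul]
    exact blockMargV_nonneg hp hV _ _ _ _

lemma testV_nonneg (hp : ∀ j q, IsPMF (p j q)) (hV : ∀ u, IsPMF (V u))
    (T S' : Finset ι) {n : ℕ} (q : Fin n → Q) (c : ∀ j, K j → Fin n → U j) (m : ∀ j, K j)
    (y : Fin n → Y) : 0 ≤ testV p V T S' q c m y :=
  mul_nonneg (inv_nonneg.2 (Nat.cast_nonneg _))
    (Finset.sum_nonneg fun _ _ => blockMargV_nonneg hp hV _ _ _ _)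

lemma demandV_nonneg (hV : ∀ u, IsPMF (V u)) (D : Finset ι) {n : ℕ}
    (c : ∀ j, K j → Fin n → U j) (m : ∀ j, K j) (y : Fin n → Y) : 0 ≤ demandV V D c m y :=
  mul_nonneg (inv_nonneg.2 (Nat.cast_nonneg _))
    (Finset.sum_nonneg fun _ _ => blockV_nonneg hV _ _)

lemma fullE_test_div_demandV_le [∀ j, Nonempty (K j)] (hq : IsPMF pq)
    (hp : ∀ j q, IsPMF (p j q)) (hV : ∀ u, IsPMF (V u)) {A D : Finset ι} (hAD : A ⊆ D)
    (S' : Finset ι) {n : ℕ}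
    (d : (Fin n → Q) → (∀ j, K j → Fin n → U j) → (Fin n → Y) → ∀ j, K j) :
    fullE (K := K) pq p V (fun (q : Fin n → Q) c m y =>
      testMsg A (d q c y) m * testV p V (D \ A) S' q c m y / demandV V D c m y) ≤ 1 := by
  have hcard : (0 : ℝ) < Fintype.card (∀ j, K j) := Nat.cast_pos.2 Fintype.card_pos
  have key : ∀ (q : Fin n → Q) (c : ∀ j, K j → Fin n → U j),
      ∑ m, ∑ y, blockV V (fun j => c j (m j)) y *
        (testMsg A (d q c y) m * testV p V (D \ A) S' q c m y / demandV V D c m y) ≤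
      Fintype.card (∀ j, K j) := by
    intro q c
    have hmsg : ∀ y, ∀ m m' : ∀ j, K j, ∀ T : Finset ι, A ⊆ T →
        testMsg A (d q c y) (T.piecewise m m') = testMsg A (d q c y) m := by
      intro y m m' T hT
      have : (∀ j ∈ A, d q c y j = T.piecewise m m' j) ↔ ∀ j ∈ A, d q c y j = m j :=
        forall₂_congr fun j hj => by simp [hT hj]
      simp only [testMsg, this]
    have htest : ∀ y, ∀ m m' : ∀ j, K j, (∀ j ∈ D \ A, m j = m' j) →
        testV p V (D \ A) S' q c m y = testV p V (D \ A) S' q c m' y := by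
      intro y m m' h
      simp only [testV]
      congr 1
      refine Finset.sum_congr rfl fun m'' _ => ?_
      rw [Finset.piecewise_congr _ h fun _ _ => rfl]
    have hdem : ∀ y, ∀ m m' : ∀ j, K j,
        demandV V D c (D.piecewise m m') y = demandV V D c m y := by
      intro y m m'
      simp only [demandV]
      congr 1
      refine Finset.sum_congr rfl fun m'' _ => ?_
      rw [Finset.piecewise_congr D (f' := m) (fun j hj => by simp [hj]) fun _ _ => rfl]
    have hy : ∀ y, ∑ m, blockV V (fun j => c j (m j)) y *
        (testMsg A (d q c y) m * testV p V (D \ A) S' q c m y / demandV V D c m y) ≤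
        ∑ m, testV p V (D \ A) S' q c m y := by
      intro y
      rw [sum_mul_eq_sum_average_mul D (fun m => blockV V (fun j => c j (m j)) y)]
      · calc _ ≤ ∑ m, testMsg A (d q c y) m * testV p V (D \ A) S' q c m y := by
              refine Finset.sum_le_sum fun m _ => ?_
              change demandV V D c m y * _ ≤ _
              rw [← mul_div_assoc]
              refine div_le_of_le_mul₀ (demandV_nonneg hV D c m y)
                (mul_nonneg (testMsg_pos _ _ _).le (testV_nonneg hp hV _ _ _ _ _ _)) ?_
              rw [mul_comm]
          _ = _ := by
              rw [sum_mul_of_piecewise A (testMsg A (d q c y))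
                (fun m => testV p V (D \ A) S' q c m y) (fun m m' => hmsg y m m' A le_rfl),
                sum_testMsg, inv_mul_cancel_left₀ hcard.ne']
              intro m m'
              refine htest y _ _ fun j hj => ?_
              simp [(Finset.mem_sdiff.1 hj).2]
      · intro m m'
        rw [hmsg y m m' D hAD, hdem, htest y (D.piecewise m m') m]
        intro j hj
        simp [(Finset.mem_sdiff.1 hj).1]
    rw [Finset.sum_comm]
    refine (Finset.sum_le_sum fun y _ => hy y).trans (le_of_eq ?_)
    rw [Finset.sum_comm]
    have h1 : ∀ m : ∀ j, K j, ∑ y, testV p V (D \ A) S' q c m y = 1 := fun m => by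
      simp only [testV]
      rw [← Finset.mul_sum, Finset.sum_comm]
      simp only [sum_blockMargV hp hV]
      simp only [Finset.sum_const, Finset.card_univ, nsmul_eq_mul, mul_one]
      exact inv_mul_cancel₀ hcard.ne'
    simp only [h1, Finset.sum_const, Finset.card_univ, nsmul_eq_mul, mul_one]
  have hq1 : ∑ q : Fin n → Q, ∏ i, pq (q i) = 1 :=
    (isPMF_prodW (A := fun _ : Fin n => Q) fun _ => hq).2
  rw [fullE_eq_ensE, ensE, ← hq1]
  refine Finset.sum_le_sum fun q _ => mul_le_of_le_one_right
    (Finset.prod_nonneg fun i _ => hq.1 _) ?_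
  have hw := isPMF_wordP hp q
  have hb : ∑ c : ∀ j, K j → Fin n → U j, bookW (wordP p q) c = 1 := by
    have h := sum_bookW_single hw (fun j => Classical.arbitrary (K j)) fun _ => (1 : ℝ)
    simpa [(isPMF_prodW hw).2] using h
  rw [← hb]
  refine Finset.sum_le_sum fun c _ => mul_le_of_le_one_right
    (bookW_nonneg (fun j a => (hw j).1 a) c) ?_
  rw [inv_mul_le_iff₀ hcard, mul_one]
  exact key q c

/-- A Fano-type inequality comparing the rate of the users in `A ⊆ D` with the information
densities at the receiver. -/
theorem ensemble_fano [∀ j, Nonempty (K j)] (hq : IsPMF pq) (hp : ∀ j q, IsPMF (p j q))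
    (hV : ∀ u, IsPMF (V u)) {A D : Finset ι} (hAD : A ⊆ D) (S' : Finset ι) {n : ℕ}
    (d : (Fin n → Q) → (∀ j, K j → Fin n → U j) → (Fin n → Y) → ∀ j, K j) :
    (1 - ensE pq p (fun q c => recvPe V D c (d q c))) * Real.log (msgProd K A) - Real.log 2 -
        Real.log (msgProd K S') +
        blockE pq p V (fun (q : Fin n → Q) u y =>
          Real.log (blockMargV p V ((D \ A) ∪ S') q u y)) ≤
      blockE pq p V (fun (q : Fin n → Q) u y => Real.log (mixV p V K D q u y)) := by
  have hcard : (0 : ℝ) < Fintype.card (∀ j, K j) := Nat.cast_pos.2 Fintype.card_pos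
  have h1 := fullE_test_div_demandV_le (K := K) hq hp hV hAD S' d
  have h2 := fullE_demandV_div_mixV_le (K := K) hq hp hV D n
  have hone : ∀ a : ℝ, fullE (K := K) pq p V (fun (_ : Fin n → Q) _ _ _ => a) = a := fun a => by
    rw [fullE_eq_blockE hp fun _ _ _ => a, blockE_const hq hp hV]
  have hPe : fullE (K := K) pq p V (fun (q : Fin n → Q) c m y =>
      if ∀ j ∈ D, d q c y j = m j then 0 else 1) =
      ensE pq p (fun q c => recvPe V D c (d q c)) := by
    rw [fullE_eq_ensE]
    rfl
  have hmono := fullE_mono (K := K) hq hp hV (n := n)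
    (F := fun q c m y =>
      (-Real.log (msgProd K A) * (if ∀ j ∈ D, d q c y j = m j then 0 else 1) +
        (Real.log (msgProd K A) - Real.log 2 - Real.log (msgProd K S') + 2)) +
        Real.log (blockMargV p V ((D \ A) ∪ S') q (fun j => c j (m j)) y))
    (G := fun q c m y =>
      (testMsg A (d q c y) m * testV p V (D \ A) S' q c m y / demandV V D c m y +
        demandV V D c m y / mixV p V K D q (fun j => c j (m j)) y) +
        Real.log (mixV p V K D q (fun j => c j (m j)) y)) ?_
  · simp only [fullE_add, hone] at hmono
    rw [fullE_const_mul, hPe,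
      fullE_eq_blockE hp fun q u y => Real.log (blockMargV p V ((D \ A) ∪ S') q u y),
      fullE_eq_blockE hp fun q u y => Real.log (mixV p V K D q u y)] at hmono
    linarith
  · intro q c m y hw
    have hbw := blockW_pos_of_fullW_pos hq hp hV hw
    have hpos := fun S => blockMargV_pos hq hp hV hbw S
    have hdem : 0 < demandV V D c m y := by
      refine mul_pos (inv_pos.2 hcard) (Finset.sum_pos' (fun _ _ => blockV_nonneg hV _ _)
        ⟨m, Finset.mem_univ m, ?_⟩)
      rw [Finset.piecewise_same]
      refine lt_of_le_of_ne (blockV_nonneg hV _ _) fun h0 => hbw.ne' ?_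
      rw [blockW, ← h0, mul_zero]
    have hmix : 0 < mixV p V K D q (fun j => c j (m j)) y :=
      Finset.sum_pos (fun S _ => mul_pos (inv_pos.2 (msgProd_pos S)) (hpos _))
        ⟨∅, Finset.empty_mem_powerset _⟩
    have hS' := msgProd_pos (K := K) S'
    have htest0 : 0 < (msgProd K S')⁻¹ *
        blockMargV p V ((D \ A) ∪ S') q (fun j => c j (m j)) y :=
      mul_pos (inv_pos.2 hS') (hpos _)
    have htest := le_testV hp hV (D \ A) S' q c m y
    have hl1 := Real.log_le_log htest0 htest
    rw [Real.log_mul (inv_pos.2 hS').ne' (hpos _).ne', Real.log_inv] at hl1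
    have hl2 := le_log_testMsg (K := K) hAD (d q c y) m
    have htv := htest0.trans_le htest
    have htm := testMsg_pos A (d q c y) m
    have hl3 := Real.log_le_sub_one_of_pos (div_pos (mul_pos htm htv) hdem)
    rw [Real.log_div (mul_pos htm htv).ne' hdem.ne', Real.log_mul htm.ne' htv.ne'] at hl3
    have hl4 := Real.log_le_sub_one_of_pos (div_pos hdem hmix)
    rw [Real.log_div hdem.ne' hmix.ne'] at hl4
    linarith

end Fano

/-! ### Asymptotics of the ensemble-average error probability -/

lemma two_rpow_eq_exp (n : ℕ) (R : ℝ) :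
    (2 : ℝ) ^ ((n : ℝ) * R) = Real.exp (n * (R * Real.log 2)) := by
  rw [Real.rpow_def_of_pos two_pos]
  congr 1
  ring

lemma one_le_msgSize (n : ℕ) (R : ℝ) : (1 : ℝ) ≤ msgSize n R :=
  Nat.one_le_cast.2 (le_max_left _ _)

lemma msgSize_le_exp (n : ℕ) {R : ℝ} (hR : 0 ≤ R) :
    (msgSize n R : ℝ) ≤ Real.exp (n * (R * Real.log 2)) := by
  have hlog := Real.log_pos one_lt_two
  rw [msgSize, Nat.cast_max, ← two_rpow_eq_exp]
  refine max_le ?_ (Nat.floor_le (by positivity))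
  rw [Nat.cast_one, two_rpow_eq_exp]
  exact Real.one_le_exp (by positivity)

lemma exp_le_two_mul_msgSize (n : ℕ) (R : ℝ) :
    Real.exp (n * (R * Real.log 2)) ≤ 2 * msgSize n R := by
  have h1 := one_le_msgSize n R
  have h2 : (⌊(2 : ℝ) ^ ((n : ℝ) * R)⌋₊ : ℝ) ≤ msgSize n R := Nat.cast_le.2 (le_max_right _ _)
  have h3 := Nat.lt_floor_add_one ((2 : ℝ) ^ ((n : ℝ) * R))
  rw [← two_rpow_eq_exp]
  linarith

lemma log_msgSize_le (n : ℕ) {R : ℝ} (hR : 0 ≤ R) :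
    Real.log (msgSize n R) ≤ n * (R * Real.log 2) := by
  rw [Real.log_le_iff_le_exp (one_pos.trans_le (one_le_msgSize n R))]
  exact msgSize_le_exp n hR

lemma le_log_msgSize (n : ℕ) (R : ℝ) :
    n * (R * Real.log 2) - Real.log 2 ≤ Real.log (msgSize n R) := by
  have h0 := one_pos.trans_le (one_le_msgSize n R)
  have h := Real.log_le_log (Real.exp_pos _) (exp_le_two_mul_msgSize n R)
  rw [Real.log_exp, Real.log_mul two_ne_zero h0.ne'] at h
  linarith

lemma pos_of_one_lt_msgSize {n : ℕ} {R : ℝ} (hR : 0 ≤ R) (h : 1 < msgSize n R) : 0 < R := by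
  refine hR.lt_of_ne fun h0 => ?_
  subst h0
  simp [msgSize] at h

section Asymptotics

variable {ι Q Y : Type*} [Fintype ι] [DecidableEq ι] [Fintype Q] [Fintype Y]
  {U : ι → Type*} [∀ j, Fintype (U j)] [∀ j, DecidableEq (U j)]
  {pq : Q → ℝ} {p : ∀ j, Q → U j → ℝ} {V : (∀ j, U j) → Y → ℝ}

open Classical in
lemma exists_blockE_not_denseAt_le (hq : IsPMF pq) (hp : ∀ j q, IsPMF (p j q))
    (hV : ∀ u, IsPMF (V u)) (S B : Finset ι) {θ : ℝ}
    (hθ : θ < condH pq p V (S \ B) - condH pq p V S) :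
    ∃ C : ℝ, ∀ n : ℕ, 0 < n → blockE pq p V (fun (q : Fin n → Q) u y =>
      if DenseAt p V S B θ q u y then 0 else 1) ≤ C / n := by
  set x : Q × (∀ j, U j) × Y → ℝ := fun z => Real.log (margV p V S z.1 z.2.1 z.2.2) -
    Real.log (margV p V (S \ B) z.1 z.2.1 z.2.2) with hx
  set I : ℝ := condH pq p V (S \ B) - condH pq p V S with hI
  have hmean : ∑ z, letterP pq p V z * x z = I := by
    simp only [hx, mul_sub, Finset.sum_sub_distrib, hI, condH]
    ring
  obtain ⟨C, -, hC⟩ := exists_blockE_sq_le hq hp hV x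
  have hδ : 0 < I - θ := sub_pos.2 hθ
  refine ⟨C / (I - θ) ^ 2, fun n hn => ?_⟩
  have hn' : (0 : ℝ) < n := Nat.cast_pos.2 hn
  have hpos : 0 < n * (I - θ) := mul_pos hn' hδ
  calc _ ≤ blockE pq p V (fun (q : Fin n → Q) u y => ((n * (I - θ)) ^ 2)⁻¹ *
        (∑ i, x (q i, (fun j => u j i), y i) - n * ∑ z, letterP pq p V z * x z) ^ 2) := by
        refine blockE_mono hq hp hV fun q u y hw => ?_
        split_ifs with hG
        · positivity
        rw [hmean]
        have hS := blockMargV_pos hq hp hV hw S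
        have hSB := blockMargV_pos hq hp hV hw (S \ B)
        have hlt : Real.exp (-(n * θ)) * blockMargV p V S q u y <
            blockMargV p V (S \ B) q u y := by
          by_contra h
          exact hG ⟨hS, not_lt.1 h⟩
        have hlog := Real.log_lt_log (mul_pos (Real.exp_pos _) hS) hlt
        rw [Real.log_mul (Real.exp_pos _).ne' hS.ne', Real.log_exp,
          log_blockMargV hq hp hV hw, log_blockMargV hq hp hV hw] at hlog
        have hsum : ∑ i, x (q i, (fun j => u j i), y i) < n * θ := by
          simp only [hx, Finset.sum_sub_distrib]
          linarith
        rw [le_inv_mul_iff₀ (by positivity), mul_one]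
        rw [← neg_sq (_ - _)]
        refine pow_le_pow_left₀ hpos.le ?_ 2
        linarith
    _ = ((n * (I - θ)) ^ 2)⁻¹ * blockE pq p V (fun (q : Fin n → Q) u y =>
        (∑ i, x (q i, (fun j => u j i), y i) - n * ∑ z, letterP pq p V z * x z) ^ 2) :=
        blockE_const_mul _ _
    _ ≤ ((n * (I - θ)) ^ 2)⁻¹ * (n * C) :=
        mul_le_mul_of_nonneg_left (hC n) (by positivity)
    _ = _ := by
        field_simp

lemma ensE_recvPe_nonneg {K : ι → Type*} [∀ j, Fintype (K j)] [∀ j, DecidableEq (K j)]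
    (hq : IsPMF pq) (hp : ∀ j q, IsPMF (p j q))
    (hV : ∀ u, IsPMF (V u)) (D : Finset ι) {n : ℕ}
    (d : (Fin n → Q) → (∀ j, K j → Fin n → U j) → (Fin n → Y) → ∀ j, K j) :
    0 ≤ ensE pq p (fun q c => recvPe V D c (d q c)) :=
  Finset.sum_nonneg fun q _ => mul_nonneg (Finset.prod_nonneg fun _ _ => hq.1 _)
    (Finset.sum_nonneg fun c _ => mul_nonneg
      (bookW_nonneg (fun j a => (isPMF_wordP hp q j).1 a) c)
      (mul_nonneg (inv_nonneg.2 (Nat.cast_nonneg _)) (Finset.sum_nonneg fun m _ =>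
        Finset.sum_nonneg fun y _ => mul_nonneg (blockV_nonneg hV _ y)
          (by split_ifs <;> norm_num))))

lemma tendsto_exp_neg_natCast_mul {δ : ℝ} (hδ : 0 < δ) :
    Tendsto (fun n : ℕ => Real.exp (-(n * δ))) atTop (nhds 0) :=
  Real.tendsto_exp_atBot.comp
    (tendsto_neg_atTop_atBot.comp (tendsto_natCast_atTop_atTop.atTop_mul_const hδ))

/-- Achievability: if the rates of the users in `S ⊇ D` lie strictly inside the multiple
access region of the receiver then the messages of the users in `D` can be decoded. -/
theorem exists_decoders_tendsto (hq : IsPMF pq) (hp : ∀ j q, IsPMF (p j q))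
    (hV : ∀ u, IsPMF (V u)) {D S : Finset ι} (hDS : D ⊆ S) {R : ι → ℝ} (hR : ∀ j, 0 ≤ R j)
    (h : ∀ B ⊆ S, B.Nonempty → (∀ j ∈ B, 0 < R j) →
      ∑ j ∈ B, R j * Real.log 2 < condH pq p V (S \ B) - condH pq p V S) :
    ∃ d : ∀ n, (Fin n → Q) → (∀ j, Fin (msgSize n (R j)) → Fin n → U j) → (Fin n → Y) →
        ∀ j, Fin (msgSize n (R j)),
      Tendsto (fun n => ensE pq p (fun q c => recvPe V D c (d n q c))) atTop (nhds 0) := by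
  classical
  set r : Finset ι → ℝ := fun B => ∑ j ∈ B, R j * Real.log 2 with hr
  set I : Finset ι → ℝ := fun B => condH pq p V (S \ B) - condH pq p V S with hI
  set θ : Finset ι → ℝ := fun B => (I B + r B) / 2 with hθ
  have hC : ∀ B : Finset ι, ∃ C : ℝ, θ B < I B → ∀ n : ℕ, 0 < n →
      blockE pq p V (fun (q : Fin n → Q) u y =>
        if DenseAt p V S B (θ B) q u y then 0 else 1) ≤ C / n := fun B => by
    by_cases hB : θ B < I B
    · obtain ⟨C, hC⟩ := exists_blockE_not_denseAt_le hq hp hV S B hB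
      exact ⟨C, fun _ => hC⟩
    · exact ⟨0, fun h => absurd h hB⟩
  choose C hC using hC
  choose d hd using fun n => exists_decoder_ensE_recvPe_le
    (K := fun j => Fin (msgSize n (R j))) hq hp hV hDS θ n
  refine ⟨d, ?_⟩
  set 𝓑 := S.powerset.filter (fun B => B.Nonempty ∧ ∀ j ∈ B, 0 < R j) with h𝓑
  have hlt : ∀ B ∈ 𝓑, r B < I B := fun B hB => by
    simp only [h𝓑, Finset.mem_filter, Finset.mem_powerset] at hB
    exact h B hB.1 hB.2.1 hB.2.2
  have hlim : Tendsto (fun n : ℕ => ∑ B ∈ 𝓑,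
      (|C B| / n + Real.exp (-(n * ((I B - r B) / 2))))) atTop (nhds 0) := by
    rw [show (0 : ℝ) = ∑ B ∈ 𝓑, (0 + 0) by simp]
    refine tendsto_finsetSum _ fun B hB => (tendsto_const_div_atTop_nhds_zero_nat _).add
      (tendsto_exp_neg_natCast_mul ?_)
    linarith [hlt B hB]
  refine tendsto_of_tendsto_of_tendsto_of_le_of_le' tendsto_const_nhds hlim
    (Eventually.of_forall fun n => ensE_recvPe_nonneg hq hp hV D (d n)) ?_
  filter_upwards [eventually_gt_atTop 0] with n hn
  refine (hd n).trans ?_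
  refine (Finset.sum_le_sum_of_subset_of_nonneg (t := 𝓑) (fun B hB => ?_)
    fun B _ _ => ?_).trans (Finset.sum_le_sum fun B hB => add_le_add ?_ ?_)
  · simp only [Finset.mem_filter, Finset.mem_powerset, Fintype.card_fin, h𝓑] at hB ⊢
    exact ⟨hB.1, hB.2.1, fun j hj => pos_of_one_lt_msgSize (hR j) (hB.2.2 j hj)⟩
  · refine add_nonneg ?_ (mul_nonneg (Finset.prod_nonneg fun _ _ => Nat.cast_nonneg _)
      (Real.exp_pos _).le)
    refine (blockE_const (n := n) hq hp hV 0).ge.trans (blockE_mono hq hp hV fun _ _ _ _ => ?_)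
    split_ifs <;> norm_num
  · have := hlt B hB
    refine (hC B (by simp only [hθ]; linarith) n hn).trans ?_
    gcongr
    exact le_abs_self _
  · simp only [Fintype.card_fin]
    calc _ ≤ Real.exp (n * r B) * Real.exp (-(n * θ B)) := by
          refine mul_le_mul_of_nonneg_right ?_ (Real.exp_pos _).le
          rw [hr, Finset.mul_sum, Real.exp_sum]
          exact Finset.prod_le_prod (fun _ _ => Nat.cast_nonneg _)
            fun j _ => msgSize_le_exp n (hR j)
      _ = _ := by
          rw [← Real.exp_add]
          congr 1
          simp only [hθ]
          ring

lemma sum_letterP_mul_log_margV (S : Finset ι) :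
    ∑ z, letterP pq p V z * Real.log (margV p V S z.1 z.2.1 z.2.2) = -condH pq p V S := by
  rw [condH, neg_neg]

lemma blockE_log_blockMargV (hq : IsPMF pq) (hp : ∀ j q, IsPMF (p j q))
    (hV : ∀ u, IsPMF (V u)) (S : Finset ι) (n : ℕ) :
    blockE pq p V (fun (q : Fin n → Q) u y => Real.log (blockMargV p V S q u y)) =
      -(n * condH pq p V S) := by
  rw [blockE_congr hq hp hV fun q u y h => log_blockMargV hq hp hV h S,
    blockE_sum_letters hq hp hV fun z => Real.log (margV p V S z.1 z.2.1 z.2.2),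
    sum_letterP_mul_log_margV, mul_neg]

lemma exists_blockE_abs_log_blockMargV_le (hq : IsPMF pq) (hp : ∀ j q, IsPMF (p j q))
    (hV : ∀ u, IsPMF (V u)) (S : Finset ι) :
    ∃ C : ℝ, ∀ n : ℕ, 0 < n → blockE pq p V (fun (q : Fin n → Q) u y =>
      |Real.log (blockMargV p V S q u y) + n * condH pq p V S|) ≤ C * √n := by
  obtain ⟨C, -, hC⟩ := exists_blockE_sq_le hq hp hV
    fun z => Real.log (margV p V S z.1 z.2.1 z.2.2)
  refine ⟨C + 1, fun n hn => ?_⟩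
  have hs : 0 < √(n : ℝ) := Real.sqrt_pos.2 (Nat.cast_pos.2 hn)
  have hss : √(n : ℝ) * √n = n := Real.mul_self_sqrt (Nat.cast_nonneg n)
  calc _ ≤ blockE pq p V (fun (q : Fin n → Q) u y => (√n)⁻¹ *
        (∑ i, Real.log (margV p V S (q i) (fun j => u j i) (y i)) - n * ∑ z, letterP pq p V z *
          Real.log (margV p V S z.1 z.2.1 z.2.2)) ^ 2 + √n) := by
        refine blockE_mono hq hp hV fun q u y hw => ?_
        rw [log_blockMargV hq hp hV hw, sum_letterP_mul_log_margV, mul_neg, sub_neg_eq_add]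
        set X := ∑ i, Real.log (margV p V S (q i) (fun j => u j i) (y i)) + n * condH pq p V S
        rw [← sub_nonneg, show (√(n : ℝ))⁻¹ * X ^ 2 + √n - |X| =
          (√(n : ℝ))⁻¹ * (|X| ^ 2 + √n * √n - √n * |X|) by rw [sq_abs]; field_simp]
        refine mul_nonneg (inv_nonneg.2 hs.le) ?_
        nlinarith [sq_nonneg (|X| - √n), mul_nonneg hs.le (abs_nonneg X)]
    _ = (√n)⁻¹ * blockE pq p V (fun (q : Fin n → Q) u y =>
        (∑ i, Real.log (margV p V S (q i) (fun j => u j i) (y i)) - n * ∑ z, letterP pq p V z *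
          Real.log (margV p V S z.1 z.2.1 z.2.2)) ^ 2) + √n := by
        rw [blockE_add, blockE_const_mul, blockE_const hq hp hV]
    _ ≤ (√n)⁻¹ * (n * C) + √n := by
        gcongr
        exact hC n
    _ = _ := by
        nth_rw 2 [← hss]
        field_simp

lemma log_msgProd_msgSize (n : ℕ) (R : ι → ℝ) (S : Finset ι) :
    Real.log (msgProd (fun j => Fin (msgSize n (R j))) S) =
      ∑ j ∈ S, Real.log (msgSize n (R j)) := by
  simp only [msgProd, Fintype.card_fin]
  exact Real.log_prod fun j _ => (one_pos.trans_le (one_le_msgSize n (R j))).ne'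

lemma log_msgProd_le (n : ℕ) {R : ι → ℝ} (hR : ∀ j, 0 ≤ R j) (S : Finset ι) :
    Real.log (msgProd (fun j => Fin (msgSize n (R j))) S) ≤
      n * ∑ j ∈ S, R j * Real.log 2 := by
  rw [log_msgProd_msgSize, Finset.mul_sum]
  exact Finset.sum_le_sum fun j _ => log_msgSize_le n (hR j)

lemma le_log_msgProd (n : ℕ) (R : ι → ℝ) (S : Finset ι) :
    n * ∑ j ∈ S, R j * Real.log 2 - Fintype.card ι * Real.log 2 ≤
      Real.log (msgProd (fun j => Fin (msgSize n (R j))) S) := by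
  have h1 : (S.card : ℝ) * Real.log 2 ≤ Fintype.card ι * Real.log 2 :=
    mul_le_mul_of_nonneg_right (Nat.cast_le.2 (Finset.card_le_univ S))
      (Real.log_pos one_lt_two).le
  have h2 := Finset.sum_le_sum fun j (_ : j ∈ S) => le_log_msgSize n (R j)
  rw [Finset.sum_sub_distrib, Finset.sum_const, nsmul_eq_mul, ← Finset.mul_sum] at h2
  rw [log_msgProd_msgSize]
  linarith

lemma exists_blockE_log_mixV_le (hq : IsPMF pq) (hp : ∀ j q, IsPMF (p j q))
    (hV : ∀ u, IsPMF (V u)) (D : Finset ι) (R : ι → ℝ) {a : ℝ}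
    (ha : ∀ S ⊆ Dᶜ, a ≤ ∑ j ∈ S, R j * Real.log 2 + condH pq p V (D ∪ S)) :
    ∃ C : ℝ, ∀ n : ℕ, 0 < n → blockE pq p V (fun (q : Fin n → Q) u y =>
      Real.log (mixV p V (fun j => Fin (msgSize n (R j))) D q u y)) ≤ C * √n - n * a := by
  choose C hC using exists_blockE_abs_log_blockMargV_le hq hp hV
  set c : ℝ := Real.log (Dᶜ.powerset.card) + Fintype.card ι * Real.log 2 with hc
  refine ⟨∑ S ∈ Dᶜ.powerset, C (D ∪ S) + |c|, fun n hn => ?_⟩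
  have hs : 1 ≤ √(n : ℝ) := Real.one_le_sqrt.2 (Nat.one_le_cast.2 hn)
  calc _ ≤ blockE pq p V (fun (q : Fin n → Q) u y =>
        (∑ S ∈ Dᶜ.powerset, |Real.log (blockMargV p V (D ∪ S) q u y) +
          n * condH pq p V (D ∪ S)|) + (c - n * a)) := by
        refine blockE_mono hq hp hV fun q u y hw => ?_
        have hpos := fun S => blockMargV_pos hq hp hV hw S
        set Z := ∑ S ∈ Dᶜ.powerset, |Real.log (blockMargV p V (D ∪ S) q u y) +
          n * condH pq p V (D ∪ S)| with hZ
        have hM := fun S : Finset ι => msgProd_pos (K := fun j => Fin (msgSize n (R j))) S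
        have hmix : 0 < mixV p V (fun j => Fin (msgSize n (R j))) D q u y :=
          Finset.sum_pos (fun S _ => mul_pos (inv_pos.2 (hM S)) (hpos _))
            ⟨∅, Finset.empty_mem_powerset _⟩
        have hcard : (0 : ℝ) < Dᶜ.powerset.card :=
          Nat.cast_pos.2 (Finset.card_pos.2 ⟨∅, Finset.empty_mem_powerset _⟩)
        rw [Real.log_le_iff_le_exp hmix, hc,
          show Z + (Real.log (Dᶜ.powerset.card) + Fintype.card ι * Real.log 2 - n * a) =
            Real.log (Dᶜ.powerset.card) + (Z + Fintype.card ι * Real.log 2 - n * a) by ring,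
          Real.exp_add, Real.exp_log hcard, mixV, ← nsmul_eq_mul]
        refine Finset.sum_le_card_nsmul _ _ _ fun S hS => ?_
        rw [← Real.log_le_iff_le_exp (mul_pos (inv_pos.2 (hM S)) (hpos _)),
          Real.log_mul (inv_pos.2 (hM S)).ne' (hpos _).ne', Real.log_inv]
        have h1 := le_log_msgProd n R S
        have h2 := mul_le_mul_of_nonneg_left (ha S (Finset.mem_powerset.1 hS))
          (Nat.cast_nonneg (α := ℝ) n)
        have h3 : |Real.log (blockMargV p V (D ∪ S) q u y) + n * condH pq p V (D ∪ S)| ≤ Z :=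
          Finset.single_le_sum (f := fun S => |Real.log (blockMargV p V (D ∪ S) q u y) +
            n * condH pq p V (D ∪ S)|) (fun S _ => abs_nonneg _) hS
        have h4 := le_abs_self (Real.log (blockMargV p V (D ∪ S) q u y) +
          n * condH pq p V (D ∪ S))
        rw [mul_add] at h2
        linarith
    _ ≤ ∑ S ∈ Dᶜ.powerset, C (D ∪ S) * √n + (c - n * a) := by
        rw [blockE_add, blockE_const hq hp hV, blockE_sum]
        gcongr with S _
        exact hC _ n hn
    _ ≤ _ := by
        rw [← Finset.sum_mul, add_mul]
        have := le_abs_self c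
        nlinarith [mul_le_mul_of_nonneg_left hs (abs_nonneg c)]

/-- Converse: if the messages of the users in `D` can be decoded then the rates lie in the
multiple access region of the receiver for some set of users containing `D`. -/
theorem exists_mac_of_tendsto (hq : IsPMF pq) (hp : ∀ j q, IsPMF (p j q))
    (hV : ∀ u, IsPMF (V u)) (D : Finset ι) {R : ι → ℝ} (hR : ∀ j, 0 ≤ R j)
    (d : ∀ n, (Fin n → Q) → (∀ j, Fin (msgSize n (R j)) → Fin n → U j) → (Fin n → Y) →
        ∀ j, Fin (msgSize n (R j)))
    (hd : Tendsto (fun n => ensE pq p (fun q c => recvPe V D c (d n q c))) atTop (nhds 0)) :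
    ∃ S : Finset ι, D ⊆ S ∧ ∀ B ⊆ S,
      ∑ j ∈ B, R j * Real.log 2 ≤ condH pq p V (S \ B) - condH pq p V S := by
  set r : Finset ι → ℝ := fun B => ∑ j ∈ B, R j * Real.log 2 with hr
  obtain ⟨T, hT, hmin⟩ := Finset.exists_min_image Dᶜ.powerset
    (fun S => r S + condH pq p V (D ∪ S)) ⟨∅, Finset.empty_mem_powerset _⟩
  rw [Finset.mem_powerset] at hT
  have hdisj : Disjoint D T := by
    rw [Finset.disjoint_left]
    exact fun j hjD hjT => Finset.mem_compl.1 (hT hjT) hjD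
  refine ⟨D ∪ T, Finset.subset_union_left, fun B hB => ?_⟩
  set Pe : ℕ → ℝ := fun n => ensE pq p (fun q c => recvPe V D c (d n q c)) with hPe
  set a : ℝ := r T + condH pq p V (D ∪ T) with ha
  obtain ⟨C, hC⟩ := exists_blockE_log_mixV_le hq hp hV D R (a := a)
    fun S hS => hmin S (Finset.mem_powerset.2 hS)
  have hset : (D \ (B ∩ D)) ∪ (T \ B) = (D ∪ T) \ B := by
    ext j
    simp only [Finset.mem_union, Finset.mem_sdiff, Finset.mem_inter]
    tauto
  have hrB : r B = r (B ∩ D) + r (B ∩ T) := by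
    rw [hr, ← Finset.sum_union (hdisj.mono Finset.inter_subset_right Finset.inter_subset_right),
      ← Finset.inter_union_distrib_left, Finset.inter_eq_left.2 hB]
  have hrT : r T = r (B ∩ T) + r (T \ B) := by
    rw [hr, Finset.inter_comm, Finset.sum_inter_add_sum_sdiff]
  set c : ℝ := (Fintype.card ι + 1) * Real.log 2 with hc
  have hbound : ∀ᶠ n : ℕ in atTop,
      r B - (condH pq p V ((D ∪ T) \ B) - condH pq p V (D ∪ T)) ≤
        Pe n * r (B ∩ D) + C / √n + c / n := by
    filter_upwards [eventually_gt_atTop 0] with n hn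
    have hn' : (0 : ℝ) < n := Nat.cast_pos.2 hn
    have hs : 0 < √(n : ℝ) := Real.sqrt_pos.2 hn'
    have hss : √(n : ℝ) * √n = n := Real.mul_self_sqrt (Nat.cast_nonneg n)
    have hfano := ensemble_fano hq hp hV (Finset.inter_subset_right : B ∩ D ⊆ D) (T \ B) (d n)
    rw [hset, blockE_log_blockMargV hq hp hV] at hfano
    have h1 := hC n hn
    have h2 := log_msgProd_le n hR (T \ B)
    have h3 := log_msgProd_le n hR (B ∩ D)
    have h4 := le_log_msgProd n R (B ∩ D)
    have hPe0 : 0 ≤ Pe n := ensE_recvPe_nonneg hq hp hV D (d n)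
    have h5 := mul_le_mul_of_nonneg_left h3 hPe0
    have hdiv : n * (Pe n * r (B ∩ D) + C / √n + c / n) =
        Pe n * (n * r (B ∩ D)) + C * √n + c := by
      have : (n : ℝ) * (C / √n) = C * √n := by
        nth_rw 1 [← hss]
        field_simp
      rw [mul_add, mul_add, this, mul_div_cancel₀ _ hn'.ne']
      ring
    refine le_of_mul_le_mul_left ?_ hn'
    rw [hdiv, hrB]
    have ha' : n * a = n * r (B ∩ T) + n * r (T \ B) + n * condH pq p V (D ∪ T) := by
      rw [ha, hrT]
      ring
    simp only [hr, hPe, hc] at *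
    linarith
  have hlim : Tendsto (fun n : ℕ => Pe n * r (B ∩ D) + C / √n + c / n) atTop (nhds 0) := by
    have h1 : Tendsto (fun n : ℕ => C / √(n : ℝ)) atTop (nhds 0) :=
      (Real.tendsto_sqrt_atTop.comp tendsto_natCast_atTop_atTop).const_div_atTop C
    simpa using ((hd.mul_const (r (B ∩ D))).add h1).add (tendsto_const_div_atTop_nhds_zero_nat c)
  have := ge_of_tendsto hlim hbound
  linarith

end Asymptotics

/-! ### Conditional mutual information at a receiver -/

section MutualInformation

lemma entOf_eq_neg_sum {Ω β : Type*} [Fintype Ω] [Fintype β] [DecidableEq β] (P : Ω → ℝ)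
    (f : Ω → β) : entOf P f = -∑ ω, P ω * Real.logb 2 (distOf P f (f ω)) := by
  rw [entOf, ent, sum_mul_eq_sum_indicator P f fun b => Real.logb 2 (distOf P f b)]
  congr 1
  refine Finset.sum_congr rfl fun b _ => ?_
  rw [mul_comm]
  simp [distOf]

variable {ι Q Y : Type*} [Fintype ι] [DecidableEq ι] [Fintype Q] [Fintype Y]
  {U : ι → Type*} [∀ j, Fintype (U j)]
  {pq : Q → ℝ} {p : ∀ j, Q → U j → ℝ} {V : (∀ j, U j) → Y → ℝ}

open Classical in
variable (pq p V) in
/-- The probability of the event that the time-sharing symbol and the inputs of the users in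
`S` agree with those of `z`. -/
def agreeP (S : Finset ι) (z : Q × (∀ j, U j) × Y) : ℝ :=
  ∑ z', if z'.1 = z.1 ∧ ∀ j ∈ S, z'.2.1 j = z.2.1 j then letterP pq p V z' else 0

open Classical in
lemma agreeP_eq (hV : ∀ u, IsPMF (V u)) (S : Finset ι) (z : Q × (∀ j, U j) × Y) :
    agreeP pq p V S z = pq z.1 * ∑ u, prodW (fun j => p j z.1) u *
      (if ∀ j ∈ S, u j = z.2.1 j then 1 else 0) := by
  rw [agreeP, Fintype.sum_prod_type, Finset.sum_eq_single z.1]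
  · rw [Fintype.sum_prod_type, Finset.mul_sum]
    refine Finset.sum_congr rfl fun u _ => ?_
    by_cases hu : ∀ j ∈ S, u j = z.2.1 j
    · simp [eq_true hu, letterP, ← Finset.mul_sum, (hV u).2]
    · simp [hu]
  · intro q _ hq
    simp [hq]
  · simp

open Classical in
lemma sum_letterP_agree_output [DecidableEq Y] (hp : ∀ j q, IsPMF (p j q)) (hV : ∀ u, IsPMF (V u))
    (S : Finset ι) (z : Q × (∀ j, U j) × Y) :
    (∑ z', if (z'.1 = z.1 ∧ ∀ j ∈ S, z'.2.1 j = z.2.1 j) ∧ z'.2.2 = z.2.2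
      then letterP pq p V z' else 0) = agreeP pq p V S z * margV p V S z.1 z.2.1 z.2.2 := by
  have hleft : (∑ z', if (z'.1 = z.1 ∧ ∀ j ∈ S, z'.2.1 j = z.2.1 j) ∧ z'.2.2 = z.2.2
      then letterP pq p V z' else 0) = pq z.1 * ∑ u, prodW (fun j => p j z.1) u *
        ((if ∀ j ∈ S, u j = z.2.1 j then 1 else 0) * V u z.2.2) := by
    rw [Fintype.sum_prod_type, Finset.sum_eq_single z.1]
    · rw [Fintype.sum_prod_type, Finset.mul_sum]
      refine Finset.sum_congr rfl fun u _ => ?_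
      by_cases hu : ∀ j ∈ S, u j = z.2.1 j
      · simp [eq_true hu, letterP, mul_assoc]
      · simp [hu]
    · intro q _ hq
      simp [hq]
    · simp
  rw [hleft, agreeP_eq hV, mul_assoc, margV, Finset.sum_mul_sum,
    ← sum_sum_prodW_piecewise_left (fun j => hp j z.1) S]
  congr 1
  refine Finset.sum_congr rfl fun u _ => Finset.sum_congr rfl fun u' _ => ?_
  have hiff : (∀ j ∈ S, S.piecewise u u' j = z.2.1 j) ↔ ∀ j ∈ S, u j = z.2.1 j :=
    forall₂_congr fun j hj => by simp [hj]
  simp only [hiff]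
  split_ifs with hu
  · rw [Finset.piecewise_congr S hu fun _ _ => rfl]
    ring
  · ring

lemma agreeP_pos (hq : IsPMF pq) (hp : ∀ j q, IsPMF (p j q)) (hV : ∀ u, IsPMF (V u))
    (S : Finset ι) {z : Q × (∀ j, U j) × Y} (hz : 0 < letterP pq p V z) :
    0 < agreeP pq p V S z := by
  classical
  refine Finset.sum_pos' (fun z' _ => ?_) ⟨z, Finset.mem_univ z, ?_⟩
  · split_ifs
    exacts [letterP_nonneg hq hp hV z', le_rfl]
  · simpa using hz

lemma entOf_eq_of_kernel {Ω β : Type*} [Fintype Ω] [Fintype β] [DecidableEq β] {P : Ω → ℝ}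
    {φ : Ω → Q × (∀ j, U j) × Y}
    (hφ : ∀ F : Q × (∀ j, U j) × Y → ℝ, ∑ ω, P ω * F (φ ω) = ∑ z, letterP pq p V z * F z)
    {f : Ω → β} {r : Q × (∀ j, U j) × Y → Q × (∀ j, U j) × Y → Prop}
    [∀ z z', Decidable (r z z')]
    (hf : ∀ ω ω', f ω' = f ω ↔ r (φ ω) (φ ω')) :
    entOf P f = -∑ z, letterP pq p V z *
      Real.logb 2 (∑ z', if r z z' then letterP pq p V z' else 0) := by
  rw [entOf_eq_neg_sum, ← hφ]
  congr 1
  refine Finset.sum_congr rfl fun ω _ => ?_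
  have h := hφ fun z' => if r (φ ω) z' then 1 else 0
  simp only [mul_ite, mul_one, mul_zero] at h
  simp only [distOf, hf, h]

/-- The conditional mutual information between the inputs of the users in `S \ T` and the
output, given the inputs of the users in `T` and the time-sharing symbol. -/
theorem condMutInfo_eq_condH_sub {Ω β δ : Type*} [Fintype Ω] [Fintype β] [DecidableEq β]
    [Fintype δ] [DecidableEq δ] [DecidableEq Y]
    (hq : IsPMF pq) (hp : ∀ j q, IsPMF (p j q)) (hV : ∀ u, IsPMF (V u)) {P : Ω → ℝ}
    {φ : Ω → Q × (∀ j, U j) × Y}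
    (hφ : ∀ F : Q × (∀ j, U j) × Y → ℝ, ∑ ω, P ω * F (φ ω) = ∑ z, letterP pq p V z * F z)
    {f : Ω → β} {g : Ω → Y} {h : Ω → δ} (S T : Finset ι)
    (hg : ∀ ω, g ω = (φ ω).2.2)
    (hh : ∀ ω ω', h ω' = h ω ↔
      (φ ω').1 = (φ ω).1 ∧ ∀ j ∈ T, (φ ω').2.1 j = (φ ω).2.1 j)
    (hf : ∀ ω ω', f ω' = f ω ∧ h ω' = h ω ↔
      (φ ω').1 = (φ ω).1 ∧ ∀ j ∈ S, (φ ω').2.1 j = (φ ω).2.1 j) :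
    condMutInfo P f g h = (condH pq p V T - condH pq p V S) / Real.log 2 := by
  classical
  have e1 := entOf_eq_of_kernel hφ (f := fun ω => (f ω, h ω))
    (r := fun z z' => z'.1 = z.1 ∧ ∀ j ∈ S, z'.2.1 j = z.2.1 j)
    fun ω ω' => by rw [Prod.mk.injEq, hf]
  have e2 := entOf_eq_of_kernel hφ (f := fun ω => (g ω, h ω))
    (r := fun z z' => (z'.1 = z.1 ∧ ∀ j ∈ T, z'.2.1 j = z.2.1 j) ∧ z'.2.2 = z.2.2)
    fun ω ω' => by rw [Prod.mk.injEq, hh, hg, hg, and_comm]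
  have e3 := entOf_eq_of_kernel hφ (f := fun ω => (f ω, g ω, h ω))
    (r := fun z z' => (z'.1 = z.1 ∧ ∀ j ∈ S, z'.2.1 j = z.2.1 j) ∧ z'.2.2 = z.2.2)
    fun ω ω' => by
      rw [Prod.mk.injEq, Prod.mk.injEq, ← hf, hg, hg]
      tauto
  have e4 := entOf_eq_of_kernel hφ (f := h)
    (r := fun z z' => z'.1 = z.1 ∧ ∀ j ∈ T, z'.2.1 j = z.2.1 j) hh
  simp only [sum_letterP_agree_output hp hV] at e2 e3
  rw [condMutInfo, e1, e2, e3, e4, condH, condH, div_eq_mul_inv]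
  have hA : ∀ S z, (∑ z', if z'.1 = z.1 ∧ ∀ j ∈ S, z'.2.1 j = z.2.1 j
      then letterP pq p V z' else 0) = agreeP pq p V S z := fun _ _ => rfl
  simp only [hA]
  rw [← sub_eq_zero]
  simp only [← Finset.sum_neg_distrib, Finset.sum_mul, sub_mul,
    ← Finset.sum_add_distrib, ← Finset.sum_sub_distrib]
  refine Finset.sum_eq_zero fun z _ => ?_
  rcases (letterP_nonneg hq hp hV z).eq_or_lt with h0 | h0
  · simp [← h0]
  · rw [Real.logb_mul (agreeP_pos hq hp hV T h0).ne' (margV_pos hq hp hV h0 T).ne',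
      Real.logb_mul (agreeP_pos hq hp hV S h0).ne' (margV_pos hq hp hV h0 S).ne']
    simp only [Real.logb, div_eq_mul_inv]
    ring

end MutualInformation

/-! ### The Han–Kobayashi network -/

section FourUsers

variable {A : Fin 4 → Type*}

/-- The dependent 4-tuple with the given entries. -/
def tuple4 (a : A 0) (b : A 1) (c : A 2) (d : A 3) : ∀ j, A j
  | 0 => a
  | 1 => b
  | 2 => c
  | 3 => d

lemma tuple4_eta (x : ∀ j, A j) : tuple4 (x 0) (x 1) (x 2) (x 3) = x := by
  funext j
  fin_cases j <;> rfl

/-- Dependent 4-tuples as iterated pairs. -/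
def tuple4Equiv : (∀ j, A j) ≃ A 0 × A 1 × A 2 × A 3 where
  toFun x := (x 0, x 1, x 2, x 3)
  invFun t := tuple4 t.1 t.2.1 t.2.2.1 t.2.2.2
  left_inv := tuple4_eta
  right_inv _ := rfl

lemma sum_prod_eq_sum_tuple4 [∀ j, Fintype (A j)] (F : A 0 × A 1 × A 2 × A 3 → ℝ) :
    ∑ t, F t = ∑ x : ∀ j, A j, F (x 0, x 1, x 2, x 3) :=
  (Equiv.sum_comp tuple4Equiv F).symm

lemma sum_sum_eq_sum_tuple4 [∀ j, Fintype (A j)] (F : A 0 → A 1 → A 2 → A 3 → ℝ) :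
    ∑ a, ∑ b, ∑ c, ∑ d, F a b c d = ∑ x : ∀ j, A j, F (x 0) (x 1) (x 2) (x 3) := by
  rw [← sum_prod_eq_sum_tuple4 fun t : A 0 × A 1 × A 2 × A 3 => F t.1 t.2.1 t.2.2.1 t.2.2.2]
  simp only [Fintype.sum_prod_type]

end FourUsers

section Network

variable {Q X1 X2 Y1 Y2 : Type*} {U : Fin 4 → Type*}
  [Fintype Q] [DecidableEq Q] [∀ j, Fintype (U j)] [∀ j, DecidableEq (U j)]
  [Fintype X1] [DecidableEq X1] [Fintype X2] [DecidableEq X2]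
  [Fintype Y1] [DecidableEq Y1] [Fintype Y2] [DecidableEq Y2]
  (W : X1 → X2 → Y1 × Y2 → ℝ) (pq : Q → ℝ) (p : ∀ j, Q → U j → ℝ)
  (g1 : U 0 → U 1 → X1) (g2 : U 2 → U 3 → X2)

/-- The channel from the auxiliary inputs to the first receiver. -/
def recvV1 (u : ∀ j, U j) (y : Y1) : ℝ := ∑ y2, W (g1 (u 0) (u 1)) (g2 (u 2) (u 3)) (y, y2)

/-- The channel from the auxiliary inputs to the second receiver. -/
def recvV2 (u : ∀ j, U j) (y : Y2) : ℝ := ∑ y1, W (g1 (u 0) (u 1)) (g2 (u 2) (u 3)) (y1, y)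

variable {W}

lemma isPMF_recvV1 (hW : ∀ x1 x2, IsPMF (W x1 x2)) (u : ∀ j, U j) : IsPMF (recvV1 W g1 g2 u) :=
  ⟨fun y => Finset.sum_nonneg fun _ _ => (hW _ _).1 _, by
    rw [← (hW (g1 (u 0) (u 1)) (g2 (u 2) (u 3))).2, Fintype.sum_prod_type]
    rfl⟩

lemma isPMF_recvV2 (hW : ∀ x1 x2, IsPMF (W x1 x2)) (u : ∀ j, U j) : IsPMF (recvV2 W g1 g2 u) :=
  ⟨fun y => Finset.sum_nonneg fun _ _ => (hW _ _).1 _, by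
    rw [← (hW (g1 (u 0) (u 1)) (g2 (u 2) (u 3))).2, Fintype.sum_prod_type_right]
    rfl⟩

variable (W)

lemma blockV_recvV1 {n : ℕ} (u : ∀ j, Fin n → U j) (y1 : Fin n → Y1) :
    blockV (recvV1 W g1 g2) u y1 = ∑ y2 : Fin n → Y2,
      ∏ i, W (g1 (u 0 i) (u 1 i)) (g2 (u 2 i) (u 3 i)) (y1 i, y2 i) := by
  simp only [blockV, recvV1]
  rw [Fintype.prod_sum]

lemma blockV_recvV2 {n : ℕ} (u : ∀ j, Fin n → U j) (y2 : Fin n → Y2) :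
    blockV (recvV2 W g1 g2) u y2 = ∑ y1 : Fin n → Y1,
      ∏ i, W (g1 (u 0 i) (u 1 i)) (g2 (u 2 i) (u 3 i)) (y1 i, y2 i) := by
  simp only [blockV, recvV2]
  rw [Fintype.prod_sum]

section Codes

variable {n : ℕ} {M : Fin 4 → ℕ}

lemma card_messages :
    (Fintype.card (∀ j, Fin (M j)) : ℝ) = (M 0 : ℝ) * M 1 * M 2 * M 3 := by
  simp [Fintype.card_pi, Fin.prod_univ_four]

lemma hkPeCode_eq (q : Fin n → Q) (c : ∀ j, Fin (M j) → Fin n → U j)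
    (d1 : (Fin n → Y1) → Fin (M 0) × Fin (M 1)) (d2 : (Fin n → Y2) → Fin (M 2) × Fin (M 3)) :
    hkPeCode W g1 g2 (q, c 0, c 1, c 2, c 3) d1 d2 = (Fintype.card (∀ j, Fin (M j)) : ℝ)⁻¹ *
      ∑ m : ∀ j, Fin (M j), ∑ y1 : Fin n → Y1, ∑ y2 : Fin n → Y2,
        (∏ i, W (g1 (c 0 (m 0) i) (c 1 (m 1) i)) (g2 (c 2 (m 2) i) (c 3 (m 3) i))
          (y1 i, y2 i)) *
          (if d1 y1 = (m 0, m 1) ∧ d2 y2 = (m 2, m 3) then 0 else 1) := by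
  rw [card_messages, hkPeCode, sum_sum_eq_sum_tuple4 (A := fun j => Fin (M j))]

lemma recvPe_recvV1_eq (c : ∀ j, Fin (M j) → Fin n → U j)
    (d : (Fin n → Y1) → ∀ j, Fin (M j)) :
    recvPe (recvV1 W g1 g2) {0, 1} c d = (Fintype.card (∀ j, Fin (M j)) : ℝ)⁻¹ *
      ∑ m : ∀ j, Fin (M j), ∑ y1 : Fin n → Y1, ∑ y2 : Fin n → Y2,
        (∏ i, W (g1 (c 0 (m 0) i) (c 1 (m 1) i)) (g2 (c 2 (m 2) i) (c 3 (m 3) i))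
          (y1 i, y2 i)) * (if (d y1 0, d y1 1) = (m 0, m 1) then 0 else 1) := by
  simp only [recvPe, blockV_recvV1, Finset.sum_mul, Finset.mem_insert, Finset.mem_singleton,
    forall_eq_or_imp, forall_eq, Prod.mk.injEq]

lemma recvPe_recvV2_eq (c : ∀ j, Fin (M j) → Fin n → U j)
    (d : (Fin n → Y2) → ∀ j, Fin (M j)) :
    recvPe (recvV2 W g1 g2) {2, 3} c d = (Fintype.card (∀ j, Fin (M j)) : ℝ)⁻¹ *
      ∑ m : ∀ j, Fin (M j), ∑ y1 : Fin n → Y1, ∑ y2 : Fin n → Y2,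
        (∏ i, W (g1 (c 0 (m 0) i) (c 1 (m 1) i)) (g2 (c 2 (m 2) i) (c 3 (m 3) i))
          (y1 i, y2 i)) * (if (d y2 2, d y2 3) = (m 2, m 3) then 0 else 1) := by
  simp only [recvPe, blockV_recvV2, Finset.sum_mul, Finset.mem_insert, Finset.mem_singleton,
    forall_eq_or_imp, forall_eq, Prod.mk.injEq]
  congr 1
  exact Finset.sum_congr rfl fun m _ => Finset.sum_comm

variable {W} in
lemma hkPeCode_le_add (hW : ∀ x1 x2, IsPMF (W x1 x2)) (q : Fin n → Q)
    (c : ∀ j, Fin (M j) → Fin n → U j) (d1 : (Fin n → Y1) → ∀ j, Fin (M j))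
    (d2 : (Fin n → Y2) → ∀ j, Fin (M j)) :
    hkPeCode W g1 g2 (q, c 0, c 1, c 2, c 3) (fun y => (d1 y 0, d1 y 1))
        (fun y => (d2 y 2, d2 y 3)) ≤
      recvPe (recvV1 W g1 g2) {0, 1} c d1 + recvPe (recvV2 W g1 g2) {2, 3} c d2 := by
  rw [hkPeCode_eq, recvPe_recvV1_eq, recvPe_recvV2_eq, ← mul_add]
  refine mul_le_mul_of_nonneg_left ?_ (inv_nonneg.2 (Nat.cast_nonneg _))
  simp only [← Finset.sum_add_distrib, ← mul_add]
  refine Finset.sum_le_sum fun m _ => Finset.sum_le_sum fun y1 _ => Finset.sum_le_sum fun y2 _ =>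
    mul_le_mul_of_nonneg_left ?_ (Finset.prod_nonneg fun _ _ => (hW _ _).1 _)
  by_cases h1 : (d1 y1 0, d1 y1 1) = (m 0, m 1) <;>
    by_cases h2 : (d2 y2 2, d2 y2 3) = (m 2, m 3) <;> simp only [h1, h2] <;> norm_num

variable {W} in
lemma recvPe_recvV1_le (hW : ∀ x1 x2, IsPMF (W x1 x2)) (q : Fin n → Q)
    (c : ∀ j, Fin (M j) → Fin n → U j) (d : (Fin n → Y1) → ∀ j, Fin (M j))
    (d2 : (Fin n → Y2) → Fin (M 2) × Fin (M 3)) :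
    recvPe (recvV1 W g1 g2) {0, 1} c d ≤
      hkPeCode W g1 g2 (q, c 0, c 1, c 2, c 3) (fun y => (d y 0, d y 1)) d2 := by
  rw [hkPeCode_eq, recvPe_recvV1_eq]
  refine mul_le_mul_of_nonneg_left ?_ (inv_nonneg.2 (Nat.cast_nonneg _))
  refine Finset.sum_le_sum fun m _ => Finset.sum_le_sum fun y1 _ => Finset.sum_le_sum fun y2 _ =>
    mul_le_mul_of_nonneg_left ?_ (Finset.prod_nonneg fun _ _ => (hW _ _).1 _)
  by_cases h1 : (d y1 0, d y1 1) = (m 0, m 1) <;>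
    by_cases h2 : d2 y2 = (m 2, m 3) <;> simp only [h1, h2] <;> norm_num

variable {W} in
lemma recvPe_recvV2_le (hW : ∀ x1 x2, IsPMF (W x1 x2)) (q : Fin n → Q)
    (c : ∀ j, Fin (M j) → Fin n → U j) (d1 : (Fin n → Y1) → Fin (M 0) × Fin (M 1))
    (d : (Fin n → Y2) → ∀ j, Fin (M j)) :
    recvPe (recvV2 W g1 g2) {2, 3} c d ≤
      hkPeCode W g1 g2 (q, c 0, c 1, c 2, c 3) d1 (fun y => (d y 2, d y 3)) := by
  rw [hkPeCode_eq, recvPe_recvV2_eq]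
  refine mul_le_mul_of_nonneg_left ?_ (inv_nonneg.2 (Nat.cast_nonneg _))
  refine Finset.sum_le_sum fun m _ => Finset.sum_le_sum fun y1 _ => Finset.sum_le_sum fun y2 _ =>
    mul_le_mul_of_nonneg_left ?_ (Finset.prod_nonneg fun _ _ => (hW _ _).1 _)
  by_cases h1 : d1 y1 = (m 0, m 1) <;>
    by_cases h2 : (d y2 2, d y2 3) = (m 2, m 3) <;> simp only [h1, h2] <;> norm_num

lemma exists_hkPeOpt_eq [∀ j, NeZero (M j)] (c : HKCodebook Q (U 0) (U 1) (U 2) (U 3) n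
      (M 0) (M 1) (M 2) (M 3)) :
    ∃ d1 d2, hkPeCode W g1 g2 c d1 d2 = hkPeOpt W g1 g2 c := by
  obtain ⟨d, hd⟩ := exists_eq_ciInf_of_finite
    (f := fun d : ((Fin n → Y1) → Fin (M 0) × Fin (M 1)) × ((Fin n → Y2) → Fin (M 2) × Fin (M 3)) =>
      hkPeCode W g1 g2 c d.1 d.2)
  exact ⟨d.1, d.2, hd⟩

lemma hkPeOpt_le (c : HKCodebook Q (U 0) (U 1) (U 2) (U 3) n (M 0) (M 1) (M 2) (M 3))
    (d1 : (Fin n → Y1) → Fin (M 0) × Fin (M 1)) (d2 : (Fin n → Y2) → Fin (M 2) × Fin (M 3)) :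
    hkPeOpt W g1 g2 c ≤ hkPeCode W g1 g2 c d1 d2 :=
  ciInf_le (f := fun d : ((Fin n → Y1) → Fin (M 0) × Fin (M 1)) ×
      ((Fin n → Y2) → Fin (M 2) × Fin (M 3)) => hkPeCode W g1 g2 c d.1 d.2)
    (Set.finite_range _).bddBelow (d1, d2)

end Codes

lemma hkAvgPe_eq_ensE (R : Fin 4 → ℝ) (n : ℕ) :
    hkAvgPe W pq (p 0) (p 1) (p 2) (p 3) g1 g2 (R 0) (R 1) (R 2) (R 3) n =
      ensE (K := fun j => Fin (msgSize n (R j))) pq p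
        (fun (q : Fin n → Q) c => hkPeOpt W g1 g2 (q, c 0, c 1, c 2, c 3)) := by
  rw [hkAvgPe, ensE, Fintype.sum_prod_type]
  refine Finset.sum_congr rfl fun q _ => ?_
  rw [sum_prod_eq_sum_tuple4 (A := fun j => Fin (msgSize n (R j)) → Fin n → U j), Finset.mul_sum]
  refine Finset.sum_congr rfl fun c _ => ?_
  simp only [hkEnsembleP, bookW, wordP, Fin.prod_univ_four]
  ring

variable {pq p} in
lemma ensE_mono {K : Fin 4 → Type*} [∀ j, Fintype (K j)] [∀ j, DecidableEq (K j)]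
    (hq : IsPMF pq) (hp : ∀ j q, IsPMF (p j q)) {n : ℕ}
    {F G : (Fin n → Q) → (∀ j, K j → Fin n → U j) → ℝ} (h : ∀ q c, F q c ≤ G q c) :
    ensE pq p F ≤ ensE pq p G :=
  Finset.sum_le_sum fun q _ => mul_le_mul_of_nonneg_left
    (Finset.sum_le_sum fun c _ => mul_le_mul_of_nonneg_left (h q c)
      (bookW_nonneg (fun j a => (isPMF_wordP hp q j).1 a) c))
    (Finset.prod_nonneg fun _ _ => hq.1 _)

variable {W pq p}

lemma hkAvgPe_le_add (hW : ∀ x1 x2, IsPMF (W x1 x2)) (hq : IsPMF pq)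
    (hp : ∀ j q, IsPMF (p j q)) (R : Fin 4 → ℝ) (n : ℕ)
    (d1 : (Fin n → Q) → (∀ j, Fin (msgSize n (R j)) → Fin n → U j) → (Fin n → Y1) →
        ∀ j, Fin (msgSize n (R j)))
    (d2 : (Fin n → Q) → (∀ j, Fin (msgSize n (R j)) → Fin n → U j) → (Fin n → Y2) →
        ∀ j, Fin (msgSize n (R j))) :
    hkAvgPe W pq (p 0) (p 1) (p 2) (p 3) g1 g2 (R 0) (R 1) (R 2) (R 3) n ≤
      ensE pq p (fun q c => recvPe (recvV1 W g1 g2) {0, 1} c (d1 q c)) +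
        ensE pq p (fun q c => recvPe (recvV2 W g1 g2) {2, 3} c (d2 q c)) := by
  rw [hkAvgPe_eq_ensE]
  refine (ensE_mono hq hp
    (G := fun q c => recvPe (recvV1 W g1 g2) {0, 1} c (d1 q c) +
      recvPe (recvV2 W g1 g2) {2, 3} c (d2 q c)) fun q c => ?_).trans (le_of_eq ?_)
  · exact (hkPeOpt_le (M := fun j => msgSize n (R j)) W g1 g2 (q, c 0, c 1, c 2, c 3)
      (fun y => (d1 q c y 0, d1 q c y 1)) (fun y => (d2 q c y 2, d2 q c y 3))).trans
      (hkPeCode_le_add (M := fun j => msgSize n (R j)) g1 g2 hW q c (d1 q c) (d2 q c))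
  simp only [ensE, mul_add, Finset.sum_add_distrib]

lemma hkAvgPe_nonneg (hW : ∀ x1 x2, IsPMF (W x1 x2)) (hq : IsPMF pq)
    (hp : ∀ j q, IsPMF (p j q)) (R : Fin 4 → ℝ) (n : ℕ) :
    0 ≤ hkAvgPe W pq (p 0) (p 1) (p 2) (p 3) g1 g2 (R 0) (R 1) (R 2) (R 3) n := by
  rw [hkAvgPe_eq_ensE]
  refine Eq.trans_le ?_ (ensE_mono hq hp (F := fun _ _ => 0) fun q c => ?_)
  · simp [ensE]
  · refine Real.iInf_nonneg fun d => ?_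
    rw [hkPeCode_eq (M := fun j => msgSize n (R j))]
    exact mul_nonneg (inv_nonneg.2 (Nat.cast_nonneg _)) (Finset.sum_nonneg fun m _ =>
      Finset.sum_nonneg fun y1 _ => Finset.sum_nonneg fun y2 _ => mul_nonneg
        (Finset.prod_nonneg fun _ _ => (hW _ _).1 _) (by split_ifs <;> norm_num))

lemma exists_decoders_le_hkAvgPe (hW : ∀ x1 x2, IsPMF (W x1 x2)) (hq : IsPMF pq)
    (hp : ∀ j q, IsPMF (p j q)) (R : Fin 4 → ℝ) (n : ℕ) :
    ∃ (d1 : (Fin n → Q) → (∀ j, Fin (msgSize n (R j)) → Fin n → U j) → (Fin n → Y1) →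
        ∀ j, Fin (msgSize n (R j)))
      (d2 : (Fin n → Q) → (∀ j, Fin (msgSize n (R j)) → Fin n → U j) → (Fin n → Y2) →
        ∀ j, Fin (msgSize n (R j))),
      ensE pq p (fun q c => recvPe (recvV1 W g1 g2) {0, 1} c (d1 q c)) ≤
        hkAvgPe W pq (p 0) (p 1) (p 2) (p 3) g1 g2 (R 0) (R 1) (R 2) (R 3) n ∧
      ensE pq p (fun q c => recvPe (recvV2 W g1 g2) {2, 3} c (d2 q c)) ≤
        hkAvgPe W pq (p 0) (p 1) (p 2) (p 3) g1 g2 (R 0) (R 1) (R 2) (R 3) n := by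
  choose d1 d2 hd using fun (q : Fin n → Q) (c : ∀ j, Fin (msgSize n (R j)) → Fin n → U j) =>
    exists_hkPeOpt_eq (M := fun j => msgSize n (R j)) W g1 g2 (q, c 0, c 1, c 2, c 3)
  refine ⟨fun q c y => tuple4 (d1 q c y).1 (d1 q c y).2 0 0,
    fun q c y => tuple4 0 0 (d2 q c y).1 (d2 q c y).2, ?_, ?_⟩
  · rw [hkAvgPe_eq_ensE]
    refine ensE_mono hq hp fun q c => ?_
    rw [← hd q c]
    exact recvPe_recvV1_le (M := fun j => msgSize n (R j)) g1 g2 hW q c _ (d2 q c)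
  · rw [hkAvgPe_eq_ensE]
    refine ensE_mono hq hp fun q c => ?_
    rw [← hd q c]
    exact recvPe_recvV2_le (M := fun j => msgSize n (R j)) g1 g2 hW q c (d1 q c) _

end Network

section SingleLetter

variable {Q X1 X2 Y1 Y2 : Type*} {U : Fin 4 → Type*}
  [Fintype Q] [DecidableEq Q] [∀ j, Fintype (U j)] [∀ j, DecidableEq (U j)]
  [Fintype X1] [DecidableEq X1] [Fintype X2] [DecidableEq X2]
  [Fintype Y1] [DecidableEq Y1] [Fintype Y2] [DecidableEq Y2]
  (W : X1 → X2 → Y1 × Y2 → ℝ) (pq : Q → ℝ) (p : ∀ j, Q → U j → ℝ)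
  (g1 : U 0 → U 1 → X1) (g2 : U 2 → U 3 → X2)

/-- The letters seen at the first receiver, as a function of the joint sample. -/
def letter1 (ω : Q × U 0 × U 1 × U 2 × U 3 × Y1 × Y2) : Q × (∀ j, U j) × Y1 :=
  (hQ ω, tuple4 (hU11 ω) (hU12 ω) (hU21 ω) (hU22 ω), hY1 ω)

/-- The letters seen at the second receiver, as a function of the joint sample. -/
def letter2 (ω : Q × U 0 × U 1 × U 2 × U 3 × Y1 × Y2) : Q × (∀ j, U j) × Y2 :=
  (hQ ω, tuple4 (hU11 ω) (hU12 ω) (hU21 ω) (hU22 ω), hY2 ω)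

lemma sum_hkJointP_letter1 (F : Q × (∀ j, U j) × Y1 → ℝ) :
    ∑ ω, hkJointP W pq (p 0) (p 1) (p 2) (p 3) g1 g2 ω * F (letter1 ω) =
      ∑ z, letterP pq p (recvV1 W g1 g2) z * F z := by
  simp only [Fintype.sum_prod_type, hkJointP, letter1, hQ, hU11, hU12, hU21, hU22, hY1, letterP,
    recvV1, prodW, Fin.prod_univ_four]
  refine Finset.sum_congr rfl fun q _ => ?_
  rw [sum_sum_eq_sum_tuple4 (A := U)]
  simp only [tuple4_eta]
  refine Finset.sum_congr rfl fun u _ => Finset.sum_congr rfl fun y _ => ?_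
  rw [Finset.mul_sum, Finset.sum_mul]
  exact Finset.sum_congr rfl fun y2 _ => by ring

lemma sum_hkJointP_letter2 (F : Q × (∀ j, U j) × Y2 → ℝ) :
    ∑ ω, hkJointP W pq (p 0) (p 1) (p 2) (p 3) g1 g2 ω * F (letter2 ω) =
      ∑ z, letterP pq p (recvV2 W g1 g2) z * F z := by
  simp only [Fintype.sum_prod_type, hkJointP, letter2, hQ, hU11, hU12, hU21, hU22, hY2, letterP,
    recvV2, prodW, Fin.prod_univ_four]
  refine Finset.sum_congr rfl fun q _ => ?_
  rw [sum_sum_eq_sum_tuple4 (A := U)]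
  simp only [tuple4_eta]
  refine Finset.sum_congr rfl fun u _ => ?_
  rw [Finset.sum_comm]
  refine Finset.sum_congr rfl fun y _ => ?_
  rw [Finset.mul_sum, Finset.sum_mul]
  exact Finset.sum_congr rfl fun y2 _ => by ring

variable {W pq p}

/-- The multiple-access constraints for decoding the messages in `S`. -/
def macHolds {Y : Type*} [Fintype Y] (pq : Q → ℝ) (p : ∀ j, Q → U j → ℝ) (V : (∀ j, U j) → Y → ℝ)
    (S : Finset (Fin 4)) (R : Fin 4 → ℝ) : Prop :=
  ∀ B ⊆ S, ∑ j ∈ B, R j * Real.log 2 ≤ condH pq p V (S \ B) - condH pq p V S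

lemma le_condMutInfo1_iff {β δ : Type*} [Fintype β] [DecidableEq β] [Fintype δ] [DecidableEq δ]
    (hW : ∀ x1 x2, IsPMF (W x1 x2)) (hq : IsPMF pq) (hp : ∀ j q, IsPMF (p j q))
    {f : Q × U 0 × U 1 × U 2 × U 3 × Y1 × Y2 → β} {h : Q × U 0 × U 1 × U 2 × U 3 × Y1 × Y2 → δ}
    (B : Finset (Fin 4)) (R : Fin 4 → ℝ) {r : ℝ} (hr : r = ∑ j ∈ B, R j)
    (hh : ∀ ω ω', h ω' = h ω ↔ (letter1 ω').1 = (letter1 ω).1 ∧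
      ∀ j ∈ ({0, 1, 2} : Finset (Fin 4)) \ B, (letter1 ω').2.1 j = (letter1 ω).2.1 j)
    (hf : ∀ ω ω', f ω' = f ω ∧ h ω' = h ω ↔ (letter1 ω').1 = (letter1 ω).1 ∧
      ∀ j ∈ ({0, 1, 2} : Finset (Fin 4)), (letter1 ω').2.1 j = (letter1 ω).2.1 j) :
    r ≤ condMutInfo (hkJointP W pq (p 0) (p 1) (p 2) (p 3) g1 g2) f hY1 h ↔
      ∑ j ∈ B, R j * Real.log 2 ≤
        condH pq p (recvV1 W g1 g2) ({0, 1, 2} \ B) - condH pq p (recvV1 W g1 g2) {0, 1, 2} := by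
  rw [condMutInfo_eq_condH_sub (g := hY1) hq hp (isPMF_recvV1 g1 g2 hW)
    (sum_hkJointP_letter1 W pq p g1 g2) {0, 1, 2} ({0, 1, 2} \ B) (fun _ => rfl) hh hf,
    le_div_iff₀ (Real.log_pos one_lt_two),
    ← Finset.sum_mul, hr]

lemma le_condMutInfo2_iff {β δ : Type*} [Fintype β] [DecidableEq β] [Fintype δ] [DecidableEq δ]
    (hW : ∀ x1 x2, IsPMF (W x1 x2)) (hq : IsPMF pq) (hp : ∀ j q, IsPMF (p j q))
    {f : Q × U 0 × U 1 × U 2 × U 3 × Y1 × Y2 → β} {h : Q × U 0 × U 1 × U 2 × U 3 × Y1 × Y2 → δ}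
    (B : Finset (Fin 4)) (R : Fin 4 → ℝ) {r : ℝ} (hr : r = ∑ j ∈ B, R j)
    (hh : ∀ ω ω', h ω' = h ω ↔ (letter2 ω').1 = (letter2 ω).1 ∧
      ∀ j ∈ ({1, 2, 3} : Finset (Fin 4)) \ B, (letter2 ω').2.1 j = (letter2 ω).2.1 j)
    (hf : ∀ ω ω', f ω' = f ω ∧ h ω' = h ω ↔ (letter2 ω').1 = (letter2 ω).1 ∧
      ∀ j ∈ ({1, 2, 3} : Finset (Fin 4)), (letter2 ω').2.1 j = (letter2 ω).2.1 j) :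
    r ≤ condMutInfo (hkJointP W pq (p 0) (p 1) (p 2) (p 3) g1 g2) f hY2 h ↔
      ∑ j ∈ B, R j * Real.log 2 ≤
        condH pq p (recvV2 W g1 g2) ({1, 2, 3} \ B) - condH pq p (recvV2 W g1 g2) {1, 2, 3} := by
  rw [condMutInfo_eq_condH_sub (g := hY2) hq hp (isPMF_recvV2 g1 g2 hW)
    (sum_hkJointP_letter2 W pq p g1 g2) {1, 2, 3} ({1, 2, 3} \ B) (fun _ => rfl) hh hf,
    le_div_iff₀ (Real.log_pos one_lt_two),
    ← Finset.sum_mul, hr]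

lemma forall_subset_zero_one_two {P : Finset (Fin 4) → Prop} :
    (∀ B ⊆ ({0, 1, 2} : Finset (Fin 4)), P B) ↔
      P ∅ ∧ P {0} ∧ P {1} ∧ P {2} ∧ P {0, 1} ∧ P {0, 2} ∧ P {1, 2} ∧ P {0, 1, 2} := by
  have h : ({0, 1, 2} : Finset (Fin 4)).powerset =
      {∅, {0}, {1}, {2}, {0, 1}, {0, 2}, {1, 2}, {0, 1, 2}} := by decide
  simp only [← Finset.mem_powerset, h, Finset.mem_insert, Finset.mem_singleton,
    forall_eq_or_imp, forall_eq]

lemma forall_subset_one_two_three {P : Finset (Fin 4) → Prop} :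
    (∀ B ⊆ ({1, 2, 3} : Finset (Fin 4)), P B) ↔
      P ∅ ∧ P {3} ∧ P {2} ∧ P {1} ∧ P {2, 3} ∧ P {3, 1} ∧ P {2, 1} ∧ P {1, 2, 3} := by
  have h : ({1, 2, 3} : Finset (Fin 4)).powerset =
      {∅, {3}, {2}, {1}, {2, 3}, {3, 1}, {2, 1}, {1, 2, 3}} := by decide
  simp only [← Finset.mem_powerset, h, Finset.mem_insert, Finset.mem_singleton,
    forall_eq_or_imp, forall_eq]

lemma hk1holds_iff (hW : ∀ x1 x2, IsPMF (W x1 x2)) (hq : IsPMF pq) (hp : ∀ j q, IsPMF (p j q))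
    (R : Fin 4 → ℝ) :
    HK1holds W pq (p 0) (p 1) (p 2) (p 3) g1 g2 (R 0) (R 1) (R 2) (R 3) ↔
      macHolds pq p (recvV1 W g1 g2) {0, 1, 2} R := by
  rw [macHolds, forall_subset_zero_one_two, HK1holds]
  refine Iff.trans ?_ (and_iff_right (by simp)).symm
  refine and_congr ?_ (and_congr ?_ (and_congr ?_ (and_congr ?_ (and_congr ?_ (and_congr ?_ ?_)))))
  all_goals
    refine le_condMutInfo1_iff g1 g2 hW hq hp _ R (by simp [add_assoc]) (fun ω ω' => ?_)
      fun ω ω' => ?_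
    all_goals
      simp [letter1, tuple4]
      try tauto

lemma hk2holds_iff (hW : ∀ x1 x2, IsPMF (W x1 x2)) (hq : IsPMF pq) (hp : ∀ j q, IsPMF (p j q))
    (R : Fin 4 → ℝ) :
    HK2holds W pq (p 0) (p 1) (p 2) (p 3) g1 g2 (R 0) (R 1) (R 2) (R 3) ↔
      macHolds pq p (recvV2 W g1 g2) {1, 2, 3} R := by
  rw [macHolds, forall_subset_one_two_three, HK2holds]
  refine Iff.trans ?_ (and_iff_right (by simp)).symm
  refine and_congr ?_ (and_congr ?_ (and_congr ?_ (and_congr ?_ (and_congr ?_ (and_congr ?_ ?_)))))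
  all_goals
    refine le_condMutInfo2_iff g1 g2 hW hq hp _ R (by simp <;> ring) (fun ω ω' => ?_)
      fun ω ω' => ?_
    all_goals
      simp [letter2, tuple4]
      try tauto

end SingleLetter

/-! ### Merging users -/

section Merge

variable {ι Q Y K : Type*} [Fintype ι] [DecidableEq ι] [Fintype Q] [Fintype Y] [Fintype K]
  {U : ι → Type*} [∀ j, Fintype (U j)] [∀ j, DecidableEq (U j)]
  (pq : Q → ℝ) (p : ∀ j, Q → U j → ℝ) (V : (∀ j, U j) → Y → ℝ)
  (e : (∀ j, U j) ≃ K) (π : ι → ι)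

/-- The input law of a user who holds a copy of all the inputs. -/
def mergeP (_ : ι) (q : Q) (x : K) : ℝ := prodW (fun j => p j q) (e.symm x)

/-- Input `j` is read off from the copy held by user `π j`. -/
def select (x : ι → K) (j : ι) : U j := e.symm (x (π j)) j

lemma isPMF_mergeP {p} (hp : ∀ j q, IsPMF (p j q)) (k : ι) (q : Q) : IsPMF (mergeP p e k q) :=
  ⟨fun x => (isPMF_prodW fun j => hp j q).1 _, by
    rw [← (isPMF_prodW fun j => hp j q).2]
    exact Equiv.sum_comp e.symm (prodW fun j => p j q)⟩

lemma sum_mergeP_select {p} (hp : ∀ j q, IsPMF (p j q)) (q : Q) (F : (∀ j, U j) → ℝ) :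
    ∑ x, prodW (fun k => mergeP p e k q) x * F (select e π x) =
      ∑ u, prodW (fun j => p j q) u * F u := by
  refine Eq.trans ?_ (sum_prodW_pushforward (Z := U) (fun j (w : ι → U j) => ∏ k, p j q (w k))
    (fun j => p j q) (fun j w => w (π j)) (fun j u => u)
    (fun j f => sum_prod_mul_coord (hp j q) (π j) f) F)
  refine Fintype.sum_equiv ((Equiv.arrowCongr (Equiv.refl ι) e.symm).trans (Equiv.piComm _)) _ _
    fun x => ?_
  simp only [prodW, mergeP]
  rw [Finset.prod_comm]
  rfl

lemma select_piecewise (S : Finset ι) (x x' : ι → K) :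
    select e π (S.piecewise x x') =
      ({j | π j ∈ S} : Finset ι).piecewise (select e π x) (select e π x') := by
  funext j
  by_cases h : π j ∈ S <;> simp [select, Finset.piecewise, h]

lemma condH_mergeP {p} (hp : ∀ j q, IsPMF (p j q)) (S : Finset ι) :
    condH pq (mergeP p e) (fun x => V (select e π x)) S = condH pq p V {j | π j ∈ S} := by
  have hm : ∀ q x y, margV (mergeP p e) (fun x => V (select e π x)) S q x y =
      margV p V {j | π j ∈ S} q (select e π x) y := fun q x y => by
    simp only [margV, select_piecewise]
    exact sum_mergeP_select e π hp q
      fun u => V (({j | π j ∈ S} : Finset ι).piecewise (select e π x) u) y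
  simp only [condH, Fintype.sum_prod_type, letterP, hm]
  congr 1
  refine Finset.sum_congr rfl fun q _ => ?_
  simp only [mul_assoc, ← Finset.mul_sum]
  congr 1
  exact sum_mergeP_select e π hp q
    fun u => ∑ y, V u y * Real.log (margV p V {j | π j ∈ S} q u y)

end Merge

section MergeFour

variable {Q Y K : Type*} [Fintype Q] [Fintype Y] [Fintype K]
  {U : Fin 4 → Type*} [∀ j, Fintype (U j)] [∀ j, DecidableEq (U j)]
  {pq : Q → ℝ} {p : ∀ j, Q → U j → ℝ} {V : (∀ j, U j) → Y → ℝ}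

lemma macHolds_mergeP (e : (∀ j, U j) ≃ K) (π : Fin 4 → Fin 4) (hp : ∀ j q, IsPMF (p j q))
    {S : Finset (Fin 4)} {R : Fin 4 → ℝ} (h : macHolds pq p V {j | π j ∈ S} R) :
    macHolds pq (mergeP p e) (fun x => V (select e π x)) S
      (fun k => ∑ j with π j = k, R j) := by
  intro B hB
  have hS : ({j | π j ∈ S \ B} : Finset (Fin 4)) =
      ({j | π j ∈ S} : Finset (Fin 4)) \ ({j | π j ∈ B} : Finset (Fin 4)) := by
    ext j
    simp
  have hB' : ({j | π j ∈ B} : Finset (Fin 4)) ⊆ ({j | π j ∈ S} : Finset (Fin 4)) := fun j => by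
    simpa using fun hj => hB hj
  rw [condH_mergeP pq V e π hp, condH_mergeP pq V e π hp, hS]
  refine Eq.trans_le ?_ (h _ hB')
  rw [← Finset.sum_mul, ← Finset.sum_mul,
    ← Finset.sum_fiberwise_of_maps_to (s := ({j | π j ∈ B} : Finset (Fin 4))) (t := B) (g := π)
      (by simp)]
  congr 1
  refine Finset.sum_congr rfl fun k hk => Finset.sum_congr ?_ fun _ _ => rfl
  ext j
  simp only [Finset.mem_filter, Finset.mem_univ, true_and]
  exact ⟨fun hj => ⟨hj ▸ hk, hj⟩, fun hj => hj.2⟩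

/-- The message parts of each sender are regrouped according to whether the other receiver
decodes them. -/
def regroup (S1 S2 : Finset (Fin 4)) : Fin 4 → Fin 4 :=
  ![if 0 ∈ S2 then 1 else 0, if 1 ∈ S2 then 1 else 0, if 2 ∈ S1 then 2 else 3,
    if 3 ∈ S1 then 2 else 3]

lemma regroup_mem_zero_one_two {S1 : Finset (Fin 4)} (S2 : Finset (Fin 4)) (h : {0, 1} ⊆ S1) :
    ({j | regroup S1 S2 j ∈ ({0, 1, 2} : Finset (Fin 4))} : Finset (Fin 4)) = S1 := by
  have h0 : 0 ∈ S1 := h (by simp)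
  have h1 : 1 ∈ S1 := h (by simp)
  ext j
  fin_cases j <;> simp [regroup, h0, h1] <;> split_ifs <;> simp_all

lemma regroup_mem_one_two_three (S1 : Finset (Fin 4)) {S2 : Finset (Fin 4)} (h : {2, 3} ⊆ S2) :
    ({j | regroup S1 S2 j ∈ ({1, 2, 3} : Finset (Fin 4))} : Finset (Fin 4)) = S2 := by
  have h2 : 2 ∈ S2 := h (by simp)
  have h3 : 3 ∈ S2 := h (by simp)
  ext j
  fin_cases j <;> simp [regroup, h2, h3] <;> split_ifs <;> simp_all

variable {X1 X2 Y1 Y2 : Type*}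
  [Fintype X1] [DecidableEq X1] [Fintype X2] [DecidableEq X2]
  [Fintype Y1] [DecidableEq Y1] [Fintype Y2] [DecidableEq Y2]
  (W : X1 → X2 → Y1 × Y2 → ℝ)
  (g1 : U 0 → U 1 → X1) (g2 : U 2 → U 3 → X2) (e : (∀ j, U j) ≃ K)

/-- The encoding map of the first sender after merging. -/
def mergeEnc1 (S2 : Finset (Fin 4)) (a b : K) : X1 :=
  g1 (e.symm (if 0 ∈ S2 then b else a) 0) (e.symm (if 1 ∈ S2 then b else a) 1)

/-- The encoding map of the second sender after merging. -/
def mergeEnc2 (S1 : Finset (Fin 4)) (a b : K) : X2 :=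
  g2 (e.symm (if 2 ∈ S1 then a else b) 2) (e.symm (if 3 ∈ S1 then a else b) 3)

lemma select_regroup (S1 S2 : Finset (Fin 4)) (x : Fin 4 → K) :
    g1 (select e (regroup S1 S2) x 0) (select e (regroup S1 S2) x 1) =
        mergeEnc1 g1 e S2 (x 0) (x 1) ∧
      g2 (select e (regroup S1 S2) x 2) (select e (regroup S1 S2) x 3) =
        mergeEnc2 g2 e S1 (x 2) (x 3) := by
  simp only [select, regroup, mergeEnc1, mergeEnc2, Matrix.cons_val, apply_ite x, and_self]

lemma recvV1_mergeEnc (S1 S2 : Finset (Fin 4)) :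
    recvV1 (U := fun _ => K) W (mergeEnc1 g1 e S2) (mergeEnc2 g2 e S1) =
      fun x => recvV1 W g1 g2 (select e (regroup S1 S2) x) := by
  funext x y
  simp only [recvV1, (select_regroup g1 g2 e S1 S2 x).1, (select_regroup g1 g2 e S1 S2 x).2]

lemma recvV2_mergeEnc (S1 S2 : Finset (Fin 4)) :
    recvV2 (U := fun _ => K) W (mergeEnc1 g1 e S2) (mergeEnc2 g2 e S1) =
      fun x => recvV2 W g1 g2 (select e (regroup S1 S2) x) := by
  funext x y
  simp only [recvV2, (select_regroup g1 g2 e S1 S2 x).1, (select_regroup g1 g2 e S1 S2 x).2]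

lemma sum_regroup (S1 S2 : Finset (Fin 4)) (R : Fin 4 → ℝ) :
    (∑ j with regroup S1 S2 j = 0, R j) + (∑ j with regroup S1 S2 j = 1, R j) = R 0 + R 1 ∧
      (∑ j with regroup S1 S2 j = 2, R j) + (∑ j with regroup S1 S2 j = 3, R j) =
        R 2 + R 3 := by
  simp only [Finset.sum_filter, Fin.sum_univ_four]
  by_cases h0 : 0 ∈ S2 <;> by_cases h1 : 1 ∈ S2 <;> by_cases h2 : 2 ∈ S1 <;>
    by_cases h3 : 3 ∈ S1 <;> simp [regroup, h0, h1, h2, h3, add_comm]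

variable {W} in
/-- Decoding any set of messages that contains the demanded ones is no better than
Han–Kobayashi decoding. -/
theorem mem_RHK_of_macHolds {nq : ℕ} {pq : Fin nq → ℝ} {p : ∀ j, Fin nq → U j → ℝ}
    (hW : ∀ x1 x2, IsPMF (W x1 x2)) (hq : IsPMF pq) (hp : ∀ j q, IsPMF (p j q))
    {S1 S2 : Finset (Fin 4)} (hS1 : {0, 1} ⊆ S1) (hS2 : {2, 3} ⊆ S2)
    {R : Fin 4 → ℝ} (hR : ∀ j, 0 ≤ R j) (h1 : macHolds pq p (recvV1 W g1 g2) S1 R)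
    (h2 : macHolds pq p (recvV2 W g1 g2) S2 R) :
    (R 0 + R 1, R 2 + R 3) ∈ RHK W := by
  let e := Fintype.equivFin (∀ j, U j)
  have hp' := isPMF_mergeP e hp
  rw [← regroup_mem_zero_one_two S2 hS1] at h1
  rw [← regroup_mem_one_two_three S1 hS2] at h2
  have h1' := macHolds_mergeP e _ hp h1
  have h2' := macHolds_mergeP e _ hp h2
  rw [← recvV1_mergeEnc, ← hk1holds_iff _ _ hW hq hp'] at h1'
  rw [← recvV2_mergeEnc, ← hk2holds_iff _ _ hW hq hp'] at h2'
  have hR' := fun k => Finset.sum_nonneg (s := {j | regroup S1 S2 j = k}) fun j _ => hR j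
  exact ⟨nq, _, _, _, _, pq, _, _, _, _, _, _, hq, hp' 0, hp' 1, hp' 2, hp' 3, _, _, _, _,
    hR' 0, hR' 1, hR' 2, hR' 3,
    by rw [(sum_regroup S1 S2 R).1, (sum_regroup S1 S2 R).2], h1', h2'⟩

end MergeFour

/-! ### The two inclusions -/

section Inclusions

lemma forall_fin_four {P : Fin 4 → Prop} (h : P 0 ∧ P 1 ∧ P 2 ∧ P 3) (j : Fin 4) : P j := by
  fin_cases j
  exacts [h.1, h.2.1, h.2.2.1, h.2.2.2]

lemma exists_eq_apply {A : Fin 4 → Type*} (a : A 0) (b : A 1) (c : A 2) (d : A 3) :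
    ∃ x : ∀ j, A j, a = x 0 ∧ b = x 1 ∧ c = x 2 ∧ d = x 3 :=
  ⟨tuple4 a b c d, rfl, rfl, rfl, rfl⟩

variable {Q X1 X2 Y1 Y2 : Type*} {U : Fin 4 → Type*}
  [Fintype Q] [DecidableEq Q] [∀ j, Fintype (U j)] [∀ j, DecidableEq (U j)]
  [Fintype X1] [DecidableEq X1] [Fintype X2] [DecidableEq X2]
  [Fintype Y1] [DecidableEq Y1] [Fintype Y2] [DecidableEq Y2]
  {W : X1 → X2 → Y1 × Y2 → ℝ} {pq : Q → ℝ} {p : ∀ j, Q → U j → ℝ}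
  (g1 : U 0 → U 1 → X1) (g2 : U 2 → U 3 → X2)

lemma macHolds.smul_lt {Y : Type*} [Fintype Y] {V : (∀ j, U j) → Y → ℝ} {S : Finset (Fin 4)}
    {R : Fin 4 → ℝ} (h : macHolds pq p V S R) {t : ℝ} (ht0 : 0 < t) (ht1 : t < 1)
    {B : Finset (Fin 4)} (hB : B ⊆ S) (hne : B.Nonempty) (hpos : ∀ j ∈ B, 0 < t * R j) :
    ∑ j ∈ B, t * R j * Real.log 2 < condH pq p V (S \ B) - condH pq p V S := by
  refine lt_of_lt_of_le (Finset.sum_lt_sum_of_nonempty hne fun j hj => ?_) (h B hB)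
  refine mul_lt_mul_of_pos_right ?_ (Real.log_pos one_lt_two)
  have := pos_of_mul_pos_right (hpos j hj) ht0.le
  nlinarith

lemma tendsto_hkAvgPe_of_macHolds (hW : ∀ x1 x2, IsPMF (W x1 x2)) (hq : IsPMF pq)
    (hp : ∀ j q, IsPMF (p j q)) {R : Fin 4 → ℝ} (hR : ∀ j, 0 ≤ R j)
    (h1 : macHolds pq p (recvV1 W g1 g2) {0, 1, 2} R)
    (h2 : macHolds pq p (recvV2 W g1 g2) {1, 2, 3} R) {t : ℝ} (ht0 : 0 < t) (ht1 : t < 1) :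
    Tendsto (hkAvgPe W pq (p 0) (p 1) (p 2) (p 3) g1 g2 (t * R 0) (t * R 1) (t * R 2) (t * R 3))
      atTop (nhds 0) := by
  have htR : ∀ j, 0 ≤ t * R j := fun j => mul_nonneg ht0.le (hR j)
  obtain ⟨d1, hd1⟩ := exists_decoders_tendsto hq hp (isPMF_recvV1 g1 g2 hW)
    (D := {0, 1}) (S := {0, 1, 2}) (by decide) htR fun B hB => h1.smul_lt ht0 ht1 hB
  obtain ⟨d2, hd2⟩ := exists_decoders_tendsto hq hp (isPMF_recvV2 g1 g2 hW)
    (D := {2, 3}) (S := {1, 2, 3}) (by decide) htR fun B hB => h2.smul_lt ht0 ht1 hB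
  refine squeeze_zero (fun n => hkAvgPe_nonneg g1 g2 hW hq hp (fun j => t * R j) n)
    (fun n => hkAvgPe_le_add g1 g2 hW hq hp (fun j => t * R j) n (d1 n) (d2 n)) ?_
  simpa using hd1.add hd2

lemma exists_macHolds_of_tendsto (hW : ∀ x1 x2, IsPMF (W x1 x2)) (hq : IsPMF pq)
    (hp : ∀ j q, IsPMF (p j q)) {R : Fin 4 → ℝ} (hR : ∀ j, 0 ≤ R j)
    (h : Tendsto (hkAvgPe W pq (p 0) (p 1) (p 2) (p 3) g1 g2 (R 0) (R 1) (R 2) (R 3))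
      atTop (nhds 0)) :
    ∃ S1 S2 : Finset (Fin 4), {0, 1} ⊆ S1 ∧ {2, 3} ⊆ S2 ∧
      macHolds pq p (recvV1 W g1 g2) S1 R ∧ macHolds pq p (recvV2 W g1 g2) S2 R := by
  choose d1 d2 hd1 hd2 using exists_decoders_le_hkAvgPe g1 g2 hW hq hp R
  obtain ⟨S1, hS1, h1⟩ := exists_mac_of_tendsto hq hp (isPMF_recvV1 g1 g2 hW) {0, 1} hR d1
    (squeeze_zero (fun n => ensE_recvPe_nonneg hq hp (isPMF_recvV1 g1 g2 hW) _ _) hd1 h)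
  obtain ⟨S2, hS2, h2⟩ := exists_mac_of_tendsto hq hp (isPMF_recvV2 g1 g2 hW) {2, 3} hR d2
    (squeeze_zero (fun n => ensE_recvPe_nonneg hq hp (isPMF_recvV2 g1 g2 hW) _ _) hd2 h)
  exact ⟨S1, S2, hS1, hS2, h1, h2⟩

lemma isClosed_macHolds {Y : Type*} [Fintype Y] (V : (∀ j, U j) → Y → ℝ) (S : Finset (Fin 4)) :
    IsClosed {R : Fin 4 → ℝ | macHolds pq p V S R} := by
  simp only [macHolds, Set.ofPred_forall]
  exact isClosed_iInter fun B => isClosed_iInter fun _ =>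
    isClosed_le (by fun_prop) continuous_const

/-- The rate tuples for which the ensemble-average error probability vanishes. -/
def achievable (W : X1 → X2 → Y1 × Y2 → ℝ) (pq : Q → ℝ) (p : ∀ j, Q → U j → ℝ) :
    Set (ℝ × ℝ × ℝ × ℝ) :=
  {u | 0 ≤ u.1 ∧ 0 ≤ u.2.1 ∧ 0 ≤ u.2.2.1 ∧ 0 ≤ u.2.2.2 ∧
    Tendsto (fun n => hkAvgPe W pq (p 0) (p 1) (p 2) (p 3) g1 g2 u.1 u.2.1 u.2.2.1 u.2.2.2 n)
      atTop (nhds 0)}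

lemma mem_closure_achievable (hW : ∀ x1 x2, IsPMF (W x1 x2)) (hq : IsPMF pq)
    (hp : ∀ j q, IsPMF (p j q)) {R : Fin 4 → ℝ} (hR : ∀ j, 0 ≤ R j)
    (h1 : macHolds pq p (recvV1 W g1 g2) {0, 1, 2} R)
    (h2 : macHolds pq p (recvV2 W g1 g2) {1, 2, 3} R) :
    (R 0, R 1, R 2, R 3) ∈ closure (achievable g1 g2 W pq p) := by
  have hlim : Tendsto (fun t : ℝ => (t * R 0, t * R 1, t * R 2, t * R 3)) (nhdsWithin 1 (Set.Iio 1))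
      (nhds (R 0, R 1, R 2, R 3)) := by
    have hc : Continuous fun t : ℝ => (t * R 0, t * R 1, t * R 2, t * R 3) := by fun_prop
    simpa using (hc.tendsto 1).mono_left nhdsWithin_le_nhds
  refine mem_closure_of_tendsto hlim ?_
  filter_upwards [Ioo_mem_nhdsLT (zero_lt_one' ℝ)] with t ht
  have htR : ∀ j, 0 ≤ t * R j := fun j => mul_nonneg ht.1.le (hR j)
  exact ⟨htR 0, htR 1, htR 2, htR 3,
    tendsto_hkAvgPe_of_macHolds g1 g2 hW hq hp hR h1 h2 ht.1 ht.2⟩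

lemma exists_macHolds_of_mem_closure (hW : ∀ x1 x2, IsPMF (W x1 x2)) (hq : IsPMF pq)
    (hp : ∀ j q, IsPMF (p j q)) {v : ℝ × ℝ × ℝ × ℝ}
    (hv : v ∈ closure (achievable g1 g2 W pq p)) :
    ∃ S1 S2 : Finset (Fin 4), {0, 1} ⊆ S1 ∧ {2, 3} ⊆ S2 ∧
      ∃ R : Fin 4 → ℝ, v = (R 0, R 1, R 2, R 3) ∧ (∀ j, 0 ≤ R j) ∧
        macHolds pq p (recvV1 W g1 g2) S1 R ∧ macHolds pq p (recvV2 W g1 g2) S2 R := by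
  let r : ℝ × ℝ × ℝ × ℝ → Fin 4 → ℝ := fun u => ![u.1, u.2.1, u.2.2.1, u.2.2.2]
  have hr : Continuous r := by fun_prop
  let C : Set (Fin 4 → ℝ) := ⋃ S1 : Finset (Fin 4), ⋃ S2 : Finset (Fin 4),
    {R | ({0, 1} ⊆ S1 ∧ {2, 3} ⊆ S2) ∧ (∀ j, 0 ≤ R j) ∧
      macHolds pq p (recvV1 W g1 g2) S1 R ∧ macHolds pq p (recvV2 W g1 g2) S2 R}
  have hC : IsClosed C := by
    refine isClosed_iUnion_of_finite fun S1 => isClosed_iUnion_of_finite fun S2 => ?_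
    refine isClosed_const.and (IsClosed.and ?_
      ((isClosed_macHolds _ _).and (isClosed_macHolds _ _)))
    simp only [Set.ofPred_forall]
    exact isClosed_iInter fun j => isClosed_le continuous_const (continuous_apply j)
  have hsub : achievable g1 g2 W pq p ⊆ r ⁻¹' C := by
    rintro u ⟨h0, h1, h2, h3, hu⟩
    have hR : ∀ j, 0 ≤ r u j := forall_fin_four ⟨h0, h1, h2, h3⟩
    obtain ⟨S1, S2, hS1, hS2, hm⟩ := exists_macHolds_of_tendsto g1 g2 hW hq hp hR hu
    exact Set.mem_iUnion₂.2 ⟨S1, S2, ⟨hS1, hS2⟩, hR, hm⟩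
  obtain ⟨S1, S2, hS, hm⟩ := Set.mem_iUnion₂.1 (closure_minimal hsub (hC.preimage hr) hv)
  exact ⟨S1, S2, hS.1, hS.2, r v, rfl, hm⟩

end Inclusions

/-- **Corollary 1.** The optimal rate region achievable by the Han–Kobayashi random code
ensemble equals the Han–Kobayashi inner bound: `𝓡_opt = 𝓡_HK`. In particular, the
Han–Kobayashi inner bound cannot be enlarged by replacing the decoders of the
Han–Kobayashi scheme with optimal maximum likelihood decoders. -/
theorem hk_inner_bound_optimal (hW : ∀ x1 x2, IsPMF (W x1 x2)) : Ropt W = RHK W := by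
  refine Set.Subset.antisymm ?_ ?_
  · rintro r ⟨nq, n11, n12, n21, n22, pq, p11, p12, p21, p22, g1, g2, hq, h11, h12, h21, h22, v,
      hv, rfl⟩
    obtain ⟨N, rfl, rfl, rfl, rfl⟩ := exists_eq_apply (A := fun _ => ℕ) n11 n12 n21 n22
    obtain ⟨p, rfl, rfl, rfl, rfl⟩ :=
      exists_eq_apply (A := fun j => Fin nq → Fin (N j) → ℝ) p11 p12 p21 p22
    have hp : ∀ j q, IsPMF (p j q) := forall_fin_four ⟨h11, h12, h21, h22⟩
    obtain ⟨S1, S2, hS1, hS2, R, rfl, hR, h1, h2⟩ :=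
      exists_macHolds_of_mem_closure (U := fun j => Fin (N j)) (p := p) g1 g2 hW hq hp hv
    exact mem_RHK_of_macHolds (U := fun j => Fin (N j)) (p := p) g1 g2 hW hq hp hS1 hS2 hR h1 h2
  · rintro r ⟨nq, n11, n12, n21, n22, pq, p11, p12, p21, p22, g1, g2, hq, h11, h12, h21, h22,
      R11, R12, R21, R22, hR11, hR12, hR21, hR22, rfl, h1, h2⟩
    obtain ⟨N, rfl, rfl, rfl, rfl⟩ := exists_eq_apply (A := fun _ => ℕ) n11 n12 n21 n22
    obtain ⟨p, rfl, rfl, rfl, rfl⟩ :=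
      exists_eq_apply (A := fun j => Fin nq → Fin (N j) → ℝ) p11 p12 p21 p22
    obtain ⟨R, rfl, rfl, rfl, rfl⟩ := exists_eq_apply (A := fun _ => ℝ) R11 R12 R21 R22
    have hp : ∀ j q, IsPMF (p j q) := forall_fin_four ⟨h11, h12, h21, h22⟩
    have hR : ∀ j, 0 ≤ R j := forall_fin_four ⟨hR11, hR12, hR21, hR22⟩
    have h1' := (hk1holds_iff (U := fun j => Fin (N j)) (p := p) g1 g2 hW hq hp R).1 h1
    have h2' := (hk2holds_iff (U := fun j => Fin (N j)) (p := p) g1 g2 hW hq hp R).1 h2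
    exact ⟨nq, N 0, N 1, N 2, N 3, pq, p 0, p 1, p 2, p 3, g1, g2, hq, h11, h12, h21, h22,
      (R 0, R 1, R 2, R 3),
      mem_closure_achievable (U := fun j => Fin (N j)) (p := p) g1 g2 hW hq hp hR h1' h2', rfl⟩

end Corollary1
end
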